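/- arXiv:math/0701721 — 5 statements merged into one kernel-verified Lean document; each statement's English description precedes it below -/
import Mathlib

section
/- Let 0 ≤ p ≤ m and 0 ≤ q ≤ n with d := p+q, and suppose either 0 ≤ d < m, or d = m < n. Then Sylv^{p,q}(A,B;x) = (−1)^{p(m−d)} · binomial(d,p) · Sres_d(f,g) in K[x]. -/
open Polynomial Finset

variable {K : Type*} [Field K]

/-- Sylvester's double sum `Sylv^{p,q}(A,B;x)`. -/
noncomputable def sylvSum {m n : ℕ} (A : Fin m → K) (B : Fin n → K) (p q : ℕ) :
    Polynomial K :=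
  ∑ Sa ∈ Finset.powersetCard p (Finset.univ : Finset (Fin m)),
    ∑ Sb ∈ Finset.powersetCard q (Finset.univ : Finset (Fin n)),
      (∏ i ∈ Sa, (X - C (A i))) * (∏ j ∈ Sb, (X - C (B j))) *
        C (((∏ i ∈ Sa, ∏ j ∈ Sb, (A i - B j)) *
            (∏ i ∈ Saᶜ, ∏ j ∈ Sbᶜ, (A i - B j))) /
           ((∏ i ∈ Sa, ∏ i' ∈ Saᶜ, (A i - A i')) *
            (∏ j ∈ Sb, ∏ j' ∈ Sbᶜ, (B j - B j'))))

/-- The matrix whose determinant defines the `k`-th subresultant of `f` (of degree `m`) and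
`g` (of degree `n`), with a general last column given by `wf` on the `f`-rows
and `wg` on the `g`-rows. -/
noncomputable def sresMatGen (m n k : ℕ) (f g : Polynomial K) (wf wg : ℕ → Polynomial K) :
    Matrix (Fin ((n - k) + (m - k))) (Fin ((n - k) + (m - k))) (Polynomial K) :=
  Matrix.of fun r c =>
    if (r : ℕ) < n - k then
      if (c : ℕ) = (n - k) + (m - k) - 1 then wf (r : ℕ)
      else if (c : ℕ) ≤ m + (r : ℕ) then C (f.coeff (m + (r : ℕ) - (c : ℕ))) else 0
    else
      if (c : ℕ) = (n - k) + (m - k) - 1 then wg ((r : ℕ) - (n - k))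
      else if (c : ℕ) ≤ n + ((r : ℕ) - (n - k)) then
        C (g.coeff (n + ((r : ℕ) - (n - k)) - (c : ℕ)))
      else 0

/-- The `k`-th subresultant `Sres_k(f,g)`. -/
noncomputable def sres (m n k : ℕ) (f g : Polynomial K) : Polynomial K :=
  (sresMatGen m n k f g (fun i => X ^ (n - k - 1 - i) * f)
    (fun i => X ^ (m - k - 1 - i) * g)).det

/-- The polynomial `F_k`: the last column is replaced by `(x^{n-k-1},…,x^0,0,…,0)ᵀ`. -/
noncomputable def sresF (m n k : ℕ) (f g : Polynomial K) : Polynomial K :=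
  (sresMatGen m n k f g (fun i => X ^ (n - k - 1 - i)) (fun _ => 0)).det

/-- The polynomial `G_k`: the last column is replaced by `(0,…,0,x^{m-k-1},…,x^0)ᵀ`. -/
noncomputable def sresG (m n k : ℕ) (f g : Polynomial K) : Polynomial K :=
  (sresMatGen m n k f g (fun _ => 0) (fun i => X ^ (m - k - 1 - i))).det

/-- The `k`-th scalar subresultant `Δ_k(f,g)`, with the convention `Δ_m(f,g) = 1`
when `m = n`. -/
noncomputable def sresDelta (m n k : ℕ) (f g : Polynomial K) : K :=
  if m = n ∧ k = m then 1 else (sres m n k f g).coeff k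

/-- The Vandermonde determinant `V(Γ)` of a list `Γ`. -/
def vand {u : ℕ} (Γ : Fin u → K) : K :=
  ∏ i : Fin u, ∏ j ∈ Finset.Ioi i, (Γ j - Γ i)

/-- The matrix `U_d(x,T)`, viewed over `(K[x])[T]`: the outer variable `X` is `T`, and
the inner variable is `x`.  Its first `m+n-d` rows are `[⟨1,B⟩_{d'} | ⟨T,A⟩_{d'}]` and its
last `d` rows are `[⟨x-t,B⟩_d | ⟨x-t,A⟩_d]`. -/
noncomputable def sylvU {m n : ℕ} (A : Fin m → K) (B : Fin n → K) (d : ℕ) :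
    Matrix (Fin (m + n)) (Fin (m + n)) (Polynomial (Polynomial K)) :=
  Matrix.of fun r c =>
    if (r : ℕ) < m + n - d then
      if h : (c : ℕ) < n then C (C (B ⟨c, h⟩ ^ (r : ℕ)))
      else X * C (C (A ⟨(c : ℕ) - n, by have := c.isLt; omega⟩ ^ (r : ℕ)))
    else
      if h : (c : ℕ) < n then
        C ((C (B ⟨c, h⟩)) ^ ((r : ℕ) - (m + n - d)) * (X - C (B ⟨c, h⟩)))
      else
        C ((C (A ⟨(c : ℕ) - n, by have := c.isLt; omega⟩)) ^ ((r : ℕ) - (m + n - d)) *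
           (X - C (A ⟨(c : ℕ) - n, by have := c.isLt; omega⟩)))

/-- The `(m+n+1)`-square matrix over `K[T]` whose first `m+n-d` rows are
`[⟨1,B⟩_{d'} | ⟨T,A⟩_{d'} | 0]` and whose last `d+1` rows are
`[⟨1,B⟩_{d+1} | ⟨1,A⟩_{d+1} | e]`, where the last column vector `e` has a single
entry `1` in (0-based) position `e₀` of the bottom block. -/
noncomputable def sylvM {m n : ℕ} (A : Fin m → K) (B : Fin n → K) (d e₀ : ℕ) :
    Matrix (Fin (m + n + 1)) (Fin (m + n + 1)) (Polynomial K) :=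
  Matrix.of fun r c =>
    if (r : ℕ) < m + n - d then
      if h : (c : ℕ) < n then C (B ⟨c, h⟩ ^ (r : ℕ))
      else if h2 : (c : ℕ) < n + m then X * C (A ⟨(c : ℕ) - n, by omega⟩ ^ (r : ℕ))
      else 0
    else
      if h : (c : ℕ) < n then C (B ⟨c, h⟩ ^ ((r : ℕ) - (m + n - d)))
      else if h2 : (c : ℕ) < n + m then
        C (A ⟨(c : ℕ) - n, by omega⟩ ^ ((r : ℕ) - (m + n - d)))
      else if (r : ℕ) - (m + n - d) = e₀ then 1 else 0

/-- The product `R(Y, Z)` of all differences `y - z`. -/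
def crossProd (Y Z : Finset K) : K :=
  ∏ y ∈ Y, ∏ z ∈ Z, (y - z)

theorem prod_sub_swap (Y : Finset K) (x : K) :
    ∏ y ∈ Y, (y - x) = (-1) ^ #Y * ∏ y ∈ Y, (x - y) := by
  rw [← Finset.prod_const, ← Finset.prod_mul_distrib]
  exact Finset.prod_congr rfl fun _ _ => by ring

theorem crossProd_swap (Y Z : Finset K) :
    crossProd Y Z = (-1) ^ (#Y * #Z) * crossProd Z Y := by
  simp only [crossProd]
  rw [Finset.prod_comm (s := Z), mul_comm #Y, pow_mul, ← Finset.prod_const,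
    ← Finset.prod_mul_distrib]
  exact Finset.prod_congr rfl fun y _ => by rw [prod_sub_swap Z y, ← mul_assoc, ← mul_pow]; simp

theorem crossProd_ne_zero {Y Z : Finset K} (h : Disjoint Y Z) : crossProd Y Z ≠ 0 :=
  Finset.prod_ne_zero_iff.2 fun _ hy => Finset.prod_ne_zero_iff.2 fun _ hz =>
    sub_ne_zero.2 fun e => Finset.disjoint_left.1 h hy (e ▸ hz)

theorem prod_sub_ne_zero {Y : Finset K} {x : K} (h : x ∉ Y) : ∏ y ∈ Y, (x - y) ≠ 0 :=
  Finset.prod_ne_zero_iff.2 fun _ hy => sub_ne_zero.2 fun e => h (e ▸ hy)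

theorem natDegree_doubleSum_term (A' B' : Finset K) (w : K) :
    ((∏ a ∈ A', (X - C a)) * (∏ b ∈ B', (X - C b)) * C w).natDegree ≤ #A' + #B' := by
  refine (natDegree_mul_C_le _ _).trans ?_
  refine natDegree_mul_le.trans ?_
  simp [natDegree_prod_of_monic, monic_X_sub_C]

theorem degree_prod_X_sub_C (A : Finset K) :
    (∏ a ∈ A, (X - C a)).degree = ((#A : ℕ) : WithBot ℕ) := by
  simp [degree_prod]

theorem sum_powersetCard_insert_of_mem_eq_zero {ι M : Type*} [DecidableEq ι] [AddCommMonoid M]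
    {s : Finset ι}
    (x : ι) (r : ℕ) (F : Finset ι → M) (hF : ∀ t, x ∈ t → F t = 0) :
    ∑ t ∈ powersetCard r (insert x s), F t = ∑ t ∈ powersetCard r s, F t := by
  refine (Finset.sum_subset (powersetCard_mono (Finset.subset_insert x s)) ?_).symm
  intro t ht ht'
  refine hF t ?_
  by_contra hx
  rw [mem_powersetCard] at ht ht'
  exact ht' ⟨(Finset.subset_insert_iff_of_notMem hx).1 ht.1, ht.2⟩

theorem sum_powersetCard_sdiff {ι M : Type*} [DecidableEq ι] [AddCommMonoid M]
    {s : Finset ι} {r : ℕ}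
    (hr : r ≤ #s) (F : Finset ι → M) :
    ∑ t ∈ powersetCard (#s - r) s, F t = ∑ t ∈ powersetCard r s, F (s \ t) := by
  refine Finset.sum_nbij' (s \ ·) (s \ ·) ?_ ?_ ?_ ?_ ?_ <;> intro t ht <;>
    rw [mem_powersetCard] at ht
  · rw [mem_powersetCard, card_sdiff_of_subset ht.1]
    exact ⟨Finset.sdiff_subset, by omega⟩
  · rw [mem_powersetCard, card_sdiff_of_subset ht.1]
    exact ⟨Finset.sdiff_subset, by omega⟩
  · exact Finset.sdiff_sdiff_eq_self ht.1
  · exact Finset.sdiff_sdiff_eq_self ht.1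
  · rw [Finset.sdiff_sdiff_eq_self ht.1]

section DoubleSum

variable [DecidableEq K]

theorem crossProd_insert_left {Y : Finset K} {x : K} (h : x ∉ Y) (Z : Finset K) :
    crossProd (insert x Y) Z = (∏ z ∈ Z, (x - z)) * crossProd Y Z :=
  Finset.prod_insert h

theorem crossProd_insert_right {Z : Finset K} {x : K} (h : x ∉ Z) (Y : Finset K) :
    crossProd Y (insert x Z) = (∏ y ∈ Y, (y - x)) * crossProd Y Z := by
  simp only [crossProd, Finset.prod_insert h, Finset.prod_mul_distrib]

/-- The coefficient of the term indexed by `(A', B')` in Sylvester's double sum. -/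
def doubleSumWeight (A B A' B' : Finset K) : K :=
  crossProd A' B' * crossProd (A \ A') (B \ B') /
    (crossProd A' (A \ A') * crossProd B' (B \ B'))

/-- Sylvester's double sum for finite sets of field elements. -/
noncomputable def doubleSum (p q : ℕ) (A B : Finset K) : K[X] :=
  ∑ A' ∈ powersetCard p A, ∑ B' ∈ powersetCard q B,
    (∏ a ∈ A', (X - C a)) * (∏ b ∈ B', (X - C b)) * C (doubleSumWeight A B A' B')

/-- The coefficient of degree `p + q` of Sylvester's double sum. -/
def doubleSumLead (p q : ℕ) (A B : Finset K) : K :=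
  ∑ A' ∈ powersetCard p A, ∑ B' ∈ powersetCard q B, doubleSumWeight A B A' B'

theorem doubleSumWeight_insert_left_of_notMem {A B A' : Finset K} {α : K} (hα : α ∉ A)
    (hA' : A' ⊆ A) (B' : Finset K) :
    doubleSumWeight (insert α A) B A' B' * ∏ a ∈ A', (α - a) =
      (-1) ^ #A' * (∏ b ∈ B \ B', (α - b)) * doubleSumWeight A B A' B' := by
  have hα' : α ∉ A' := fun h => hα (hA' h)
  have h1 : α ∉ A \ A' := fun h => hα (Finset.mem_sdiff.1 h).1
  have h2 := prod_sub_ne_zero hα'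
  have h3 : crossProd A' (A \ A') ≠ 0 := crossProd_ne_zero Finset.disjoint_sdiff
  have h4 : crossProd B' (B \ B') ≠ 0 := crossProd_ne_zero Finset.disjoint_sdiff
  have h5 : ((-1 : K) ^ #A') ^ 2 = 1 := by rw [← pow_mul, mul_comm, pow_mul]; simp
  have h6 : (-1 : K) ^ #A' ≠ 0 := by simp
  rw [doubleSumWeight, doubleSumWeight, Finset.insert_sdiff_of_notMem _ hα',
    crossProd_insert_left h1, crossProd_insert_right h1, prod_sub_swap]
  generalize (-1 : K) ^ #A' = s at *
  field_simp
  linear_combination (-(crossProd A' B' * (∏ z ∈ B \ B', (α - z)) * crossProd (A \ A') (B \ B'))) * h5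

theorem doubleSumWeight_insert_left_of_mem {A B A' : Finset K} {α : K} (hα : α ∉ A)
    (hA' : A' ⊆ A) (B' : Finset K) :
    doubleSumWeight (insert α A) B (insert α A') B' * ∏ a ∈ A \ A', (α - a) =
      (∏ b ∈ B', (α - b)) * doubleSumWeight A B A' B' := by
  have hα' : α ∉ A' := fun h => hα (hA' h)
  have h1 : α ∉ A \ A' := fun h => hα (Finset.mem_sdiff.1 h).1
  have h2 := prod_sub_ne_zero h1
  have h3 : crossProd A' (A \ A') ≠ 0 := crossProd_ne_zero Finset.disjoint_sdiff
  have h4 : crossProd B' (B \ B') ≠ 0 := crossProd_ne_zero Finset.disjoint_sdiff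
  have h5 : insert α A \ insert α A' = A \ A' := by grind
  rw [doubleSumWeight, doubleSumWeight, h5, crossProd_insert_left hα',
    crossProd_insert_left hα']
  field_simp

theorem doubleSumWeight_insert_right_of_notMem {A B B' : Finset K} {β : K} (hβ : β ∉ B)
    (hB' : B' ⊆ B) (A' : Finset K) :
    doubleSumWeight A (insert β B) A' B' * ∏ b ∈ B', (β - b) =
      (-1) ^ (#B' + #(A \ A')) * (∏ a ∈ A \ A', (β - a)) * doubleSumWeight A B A' B' := by
  have hβ' : β ∉ B' := fun h => hβ (hB' h)
  have h1 : β ∉ B \ B' := fun h => hβ (Finset.mem_sdiff.1 h).1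
  have h2 := prod_sub_ne_zero hβ'
  have h3 : crossProd A' (A \ A') ≠ 0 := crossProd_ne_zero Finset.disjoint_sdiff
  have h4 : crossProd B' (B \ B') ≠ 0 := crossProd_ne_zero Finset.disjoint_sdiff
  have h5 : ((-1 : K) ^ #B') ^ 2 = 1 := by rw [← pow_mul, mul_comm, pow_mul]; simp
  have h6 : (-1 : K) ^ #B' ≠ 0 := by simp
  rw [doubleSumWeight, doubleSumWeight, Finset.insert_sdiff_of_notMem _ hβ',
    crossProd_insert_right h1, crossProd_insert_right h1, prod_sub_swap, prod_sub_swap, pow_add]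
  generalize (-1 : K) ^ #B' = s at *
  field_simp
  linear_combination (-(crossProd A' B' * (∏ z ∈ A \ A', (β - z)) * crossProd (A \ A') (B \ B'))) * h5

theorem doubleSumWeight_sdiff_sdiff {A B A' B' : Finset K} (hA' : A' ⊆ A) (hB' : B' ⊆ B) :
    doubleSumWeight A B (A \ A') (B \ B') =
      (-1) ^ (#A' * #(A \ A') + #B' * #(B \ B')) * doubleSumWeight A B A' B' := by
  rw [doubleSumWeight, doubleSumWeight, Finset.sdiff_sdiff_eq_self hA',
    Finset.sdiff_sdiff_eq_self hB', crossProd_swap A' (A \ A'), crossProd_swap B' (B \ B'),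
    pow_add]
  have h1 : (-1 : K) ^ (#A' * #(A \ A')) ≠ 0 := by simp
  have h2 : (-1 : K) ^ (#B' * #(B \ B')) ≠ 0 := by simp
  have h3 : crossProd (A \ A') A' ≠ 0 := crossProd_ne_zero Finset.sdiff_disjoint
  have h4 : crossProd (B \ B') B' ≠ 0 := crossProd_ne_zero Finset.sdiff_disjoint
  generalize (-1 : K) ^ (#A' * #(A \ A')) = s at *
  generalize (-1 : K) ^ (#B' * #(B \ B')) = t at *
  field_simp

theorem degree_doubleSum_le (p q : ℕ) (A B : Finset K) :
    (doubleSum p q A B).degree ≤ (p + q : ℕ) := by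
  refine natDegree_le_iff_degree_le.1 ?_
  refine natDegree_sum_le_of_forall_le _ _ fun A' hA' => ?_
  refine natDegree_sum_le_of_forall_le _ _ fun B' hB' => ?_
  rw [← (mem_powersetCard.1 hA').2, ← (mem_powersetCard.1 hB').2]
  exact natDegree_doubleSum_term A' B' _

theorem coeff_doubleSum (p q : ℕ) (A B : Finset K) :
    (doubleSum p q A B).coeff (p + q) = doubleSumLead p q A B := by
  simp only [doubleSum, doubleSumLead, finsetSum_coeff, coeff_mul_C]
  refine Finset.sum_congr rfl fun A' hA' => Finset.sum_congr rfl fun B' hB' => ?_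
  have h : ((∏ a ∈ A', (X - C a)) * (∏ b ∈ B', (X - C b))).Monic :=
    (monic_prod_of_monic _ _ fun a _ => monic_X_sub_C a).mul
      (monic_prod_of_monic _ _ fun a _ => monic_X_sub_C a)
  have h' : ((∏ a ∈ A', (X - C a)) * (∏ b ∈ B', (X - C b))).natDegree = p + q := by
    rw [Monic.natDegree_mul (monic_prod_of_monic _ _ fun a _ => monic_X_sub_C a)
      (monic_prod_of_monic _ _ fun a _ => monic_X_sub_C a)]
    simp [natDegree_prod_of_monic, monic_X_sub_C, (mem_powersetCard.1 hA').2,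
      (mem_powersetCard.1 hB').2]
  rw [← h', h.coeff_natDegree, one_mul]

theorem eval_doubleSum (p q : ℕ) (A B : Finset K) (x : K) :
    (doubleSum p q A B).eval x = ∑ A' ∈ powersetCard p A, ∑ B' ∈ powersetCard q B,
      (∏ a ∈ A', (x - a)) * (∏ b ∈ B', (x - b)) * doubleSumWeight A B A' B' := by
  simp [doubleSum, eval_finsetSum, eval_prod]

theorem eval_doubleSum_insert_left {A : Finset K} {α : K} (hα : α ∉ A) (B : Finset K)
    (p q : ℕ) :
    (doubleSum p q (insert α A) B).eval α =
      (-1) ^ p * (∏ b ∈ B, (α - b)) * doubleSumLead p q A B := by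
  rw [eval_doubleSum, sum_powersetCard_insert_of_mem_eq_zero, doubleSumLead, Finset.mul_sum]
  · refine Finset.sum_congr rfl fun A' hA' => ?_
    rw [Finset.mul_sum]
    refine Finset.sum_congr rfl fun B' hB' => ?_
    rw [mem_powersetCard] at hA' hB'
    have h := doubleSumWeight_insert_left_of_notMem (B := B) hα hA'.1 B'
    rw [hA'.2] at h
    rw [← Finset.prod_sdiff hB'.1]
    linear_combination (∏ b ∈ B', (α - b)) * h
  · intro t ht
    rw [Finset.prod_eq_zero ht (sub_self α)]
    simp

theorem eval_doubleSum_insert_right {B : Finset K} {β : K} (hβ : β ∉ B) (A : Finset K)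
    {p q : ℕ} (h : #A = p + q) :
    (doubleSum p q A (insert β B)).eval β =
      (∏ a ∈ A, (β - a)) * doubleSumLead p q A B := by
  rw [eval_doubleSum, doubleSumLead, Finset.mul_sum]
  refine Finset.sum_congr rfl fun A' hA' => ?_
  rw [sum_powersetCard_insert_of_mem_eq_zero, Finset.mul_sum]
  · refine Finset.sum_congr rfl fun B' hB' => ?_
    rw [mem_powersetCard] at hA' hB'
    have h := doubleSumWeight_insert_right_of_notMem (A := A) hβ hB'.1 A'
    rw [card_sdiff_of_subset hA'.1, hA'.2, hB'.2, show q + (#A - p) = 2 * q by omega, pow_mul,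
      neg_one_sq, one_pow, one_mul] at h
    rw [← Finset.prod_sdiff hA'.1]
    linear_combination (∏ a ∈ A', (β - a)) * h
  · intro t ht
    rw [Finset.prod_eq_zero ht (sub_self β)]
    simp

theorem doubleSumLead_insert_left {A B : Finset K} {α : K} (hα : α ∉ A) {p q : ℕ}
    (hA : #A = p + q) (hB : #B = p + q + 1) :
    doubleSumLead (p + 1) q (insert α A) B * ∏ a ∈ A, (α - a) =
      (doubleSum p q A B).eval α +
        if p + 1 ≤ #A then (doubleSum (#A - (p + 1)) (#B - q) A B).eval α else 0 := by
  rw [doubleSumLead, powersetCard_succ_insert hα, Finset.sum_union, Finset.sum_image, add_mul,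
    add_comm, eval_doubleSum, eval_doubleSum]
  · congr 1
    · rw [Finset.sum_mul]
      refine Finset.sum_congr rfl fun A' hA' => ?_
      rw [Finset.sum_mul]
      refine Finset.sum_congr rfl fun B' hB' => ?_
      rw [mem_powersetCard] at hA' hB'
      have h := doubleSumWeight_insert_left_of_mem (B := B) hα hA'.1 B'
      rw [← Finset.prod_sdiff hA'.1]
      linear_combination (∏ a ∈ A', (α - a)) * h
    · split_ifs with hp
      · rw [sum_powersetCard_sdiff hp, Finset.sum_mul]
        refine Finset.sum_congr rfl fun A' hA' => ?_
        rw [sum_powersetCard_sdiff (by omega), Finset.sum_mul]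
        refine Finset.sum_congr rfl fun B' hB' => ?_
        rw [mem_powersetCard] at hA' hB'
        have h := doubleSumWeight_insert_left_of_notMem (B := B) hα hA'.1 B'
        rw [doubleSumWeight_sdiff_sdiff hA'.1 hB'.1, card_sdiff_of_subset hA'.1,
          card_sdiff_of_subset hB'.1, hA'.2, hB'.2, ← Finset.prod_sdiff hA'.1]
        rw [hA'.2] at h
        have e : (-1 : K) ^ ((p + 1) * (#A - (p + 1)) + q * (#B - q)) = (-1) ^ (p + 1) := by
          obtain ⟨r, rfl⟩ : ∃ r, q = r + 1 := ⟨q - 1, by omega⟩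
          rw [hA, hB, show p + (r + 1) - (p + 1) = r by omega,
            show p + (r + 1) + 1 - (r + 1) = p + 1 by omega,
            show (p + 1) * r + (r + 1) * (p + 1) = 2 * ((p + 1) * r) + (p + 1) by ring,
            pow_add, pow_mul]
          simp
        rw [e]
        linear_combination (∏ a ∈ A \ A', (α - a)) * h
      · rw [powersetCard_eq_empty.2 (by omega)]
        simp
  · intro s hs t ht hst
    have hs' : α ∉ s := fun h => hα ((mem_powersetCard.1 hs).1 h)
    have ht' : α ∉ t := fun h => hα ((mem_powersetCard.1 ht).1 h)
    rw [← Finset.erase_insert hs', ← Finset.erase_insert ht', hst]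
  · refine Finset.disjoint_left.2 fun s hs hs' => ?_
    obtain ⟨t, -, rfl⟩ := Finset.mem_image.1 hs'
    exact hα ((mem_powersetCard.1 hs).1 (Finset.mem_insert_self α t))

theorem doubleSumLead_zero_card (A B : Finset K) (q : ℕ) (hB : #B = q) :
    doubleSumLead 0 q A B = 1 := by
  subst hB
  simp [doubleSumLead, doubleSumWeight, crossProd]

theorem doubleSum_eq_of_doubleSumLead_eq {A B : Finset K} {p q : ℕ} (hA : #A = p + q)
    (hB : p + q < #B) (h : ∀ β ∈ B, doubleSumLead p q A (B.erase β) = (p + q).choose p) :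
    doubleSum p q A B = ((p + q).choose p : K[X]) * ∏ a ∈ A, (X - C a) := by
  refine eq_of_degrees_lt_of_eval_finset_eq B
    ((degree_doubleSum_le p q A B).trans_lt (mod_cast hB)) ?_ fun β hβ => ?_
  · rw [← C_eq_natCast, ← smul_eq_C_mul]
    refine (degree_smul_le _ _).trans_lt ?_
    rw [degree_prod_X_sub_C, hA]
    exact_mod_cast hB
  · have e := eval_doubleSum_insert_right (Finset.notMem_erase β B) A hA
    rw [Finset.insert_erase hβ, h β hβ] at e
    rw [e]
    simp [eval_prod, mul_comm]

theorem doubleSumLead_eq_choose {A B : Finset K} {p q : ℕ} (hA : #A = p + q)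
    (hB : p + q ≤ #B) : doubleSumLead p q A B = (p + q).choose p := by
  induction hk : #A + #B using Nat.strong_induction_on generalizing A B p q with
  | _ k ih =>
    have key : ∀ {A' B' : Finset K} {p' q' : ℕ}, #A' = p' + q' → p' + q' < #B' →
        #A' + #B' ≤ k → doubleSum p' q' A' B' =
          ((p' + q').choose p' : K[X]) * ∏ a ∈ A', (X - C a) := by
      intro A' B' p' q' hA' hB' hk'
      refine doubleSum_eq_of_doubleSumLead_eq hA' hB' fun β hβ => ?_
      have hc := Finset.card_erase_of_mem hβ
      exact ih (#A' + #(B'.erase β)) (by omega) hA' (by omega) rfl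
    rcases hB.lt_or_eq with hB | hB
    · rw [← coeff_doubleSum, key hA hB hk.le, ← C_eq_natCast, coeff_C_mul]
      have hm : (∏ a ∈ A, (X - C a)).Monic := monic_prod_of_monic _ _ fun a _ => monic_X_sub_C a
      have hd : (∏ a ∈ A, (X - C a)).natDegree = p + q := by
        simp [natDegree_prod_of_monic, monic_X_sub_C, hA]
      rw [← hd, hm.coeff_natDegree, mul_one]
    · rcases p with _ | p
      · rw [doubleSumLead_zero_card A B q (by omega)]
        simp
      · obtain ⟨α, hα⟩ : A.Nonempty := card_pos.1 (by omega)
        have hc := Finset.card_erase_of_mem hα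
        have e := doubleSumLead_insert_left (Finset.notMem_erase α A) (p := p) (q := q) (B := B)
          (by omega) (by omega)
        rw [Finset.insert_erase hα] at e
        have h0 := prod_sub_ne_zero (Finset.notMem_erase α A)
        refine mul_right_cancel₀ h0 ?_
        rw [e, key (by omega) (by omega) (by omega)]
        split_ifs with hp
        · rw [key (by omega) (by omega) (by omega)]
          have h1 : (p + 1 + q).choose (p + 1) = (p + q).choose p +
              (#(A.erase α) - (p + 1) + (#B - q)).choose (#(A.erase α) - (p + 1)) := by
            rw [show p + 1 + q = p + q + 1 by ring, Nat.choose_succ_succ,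
              Nat.choose_symm_of_eq_add (n := p + q) (a := p.succ) (b := #(A.erase α) - (p + 1))
                (by omega), show #(A.erase α) - (p + 1) + (#B - q) = p + q by omega]
          rw [h1]
          simp [eval_prod]
          ring
        · obtain rfl : q = 0 := by omega
          simp [eval_prod]

theorem doubleSum_eq_choose_mul {A B : Finset K} {p q : ℕ} (hA : #A = p + q)
    (hB : p + q < #B) :
    doubleSum p q A B = ((p + q).choose p : K[X]) * ∏ a ∈ A, (X - C a) :=
  doubleSum_eq_of_doubleSumLead_eq hA hB fun β hβ => by
    have hc := Finset.card_erase_of_mem hβ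
    exact doubleSumLead_eq_choose hA (by omega)

end DoubleSum

section SubresultantMatrix

/-- Column operations from right to left do not change the determinant. -/
theorem det_eq_of_forall_col_eq_smul_add_succ {R : Type*} [CommRing R] {n : ℕ}
    {A B : Matrix (Fin (n + 1)) (Fin (n + 1)) R} (c : R)
    (h_last : ∀ i, A i (Fin.last n) = B i (Fin.last n))
    (h_castSucc : ∀ i (j : Fin n), A i j.castSucc = B i j.castSucc + c * A i j.succ) :
    A.det = B.det := by
  rw [← Matrix.det_submatrix_equiv_self Fin.revPerm A,
    ← Matrix.det_submatrix_equiv_self Fin.revPerm B]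
  refine Matrix.det_eq_of_forall_col_eq_smul_add_pred (fun _ => c) (fun i => ?_) fun i j => ?_
  · simpa using h_last i.rev
  · simpa [Fin.rev_succ, Fin.rev_castSucc] using h_castSucc i.rev j.rev

/-- The matrix whose row `i` consists of `v i` followed by the coefficients of degrees
`d + 1, d + 2, …` of the polynomial `P i`. -/
def coeffMatrix (N d : ℕ) (P : ℕ → K[X]) (v : ℕ → K) : Matrix (Fin N) (Fin N) K :=
  Matrix.of fun i j => if (j : ℕ) = 0 then v i else (P i).coeff (d + j)

/-- The polynomials `g, X * g, …, X ^ (b - 1) * g, f, X * f, …` -/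
noncomputable def sylvesterRow (b : ℕ) (f g : K[X]) (i : ℕ) : K[X] :=
  if i < b then X ^ i * g else X ^ (i - b) * f

theorem coeff_X_pow_mul_sub (f : K[X]) {e s t u : ℕ} (h : t + e = u + s) :
    (X ^ s * f).coeff t = if e ≤ u then f.coeff (u - e) else 0 := by
  rw [coeff_X_pow_mul']
  by_cases hs : s ≤ t
  · rw [if_pos hs, if_pos (by omega), show t - s = u - e by omega]
  · rw [if_neg hs, if_neg (by omega)]

theorem sres_eq_det_reverse (m n k : ℕ) (hm : k ≤ m) (hn : k ≤ n) (f g : K[X]) :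
    sres m n k f g = (Matrix.of fun i j : Fin (n - k + (m - k)) =>
      if (j : ℕ) = 0 then sylvesterRow (m - k) f g i
      else C ((sylvesterRow (m - k) f g i).coeff (k + j))).det := by
  rw [sres, ← Matrix.det_submatrix_equiv_self Fin.revPerm]
  congr 1
  ext1 i j
  have hi := i.isLt
  have hj := j.isLt
  simp only [sresMatGen, Matrix.submatrix_apply, Matrix.of_apply, Fin.revPerm_apply, Fin.val_rev,
    sylvesterRow]
  by_cases hj0 : (j : ℕ) = 0
  · by_cases hib : (i : ℕ) < m - k
    · rw [if_neg (by omega), if_pos (by omega), if_pos hj0, if_pos hib]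
      congr 2
      omega
    · rw [if_pos (by omega), if_pos (by omega), if_pos hj0, if_neg hib]
      congr 2
      omega
  · by_cases hib : (i : ℕ) < m - k
    · rw [if_neg (by omega), if_neg (by omega), if_neg hj0, if_pos hib,
        coeff_X_pow_mul_sub (e := n - k + (m - k) - (j + 1))
          (u := n + (n - k + (m - k) - (i + 1) - (n - k))) _ (by omega), apply_ite C, C_0]
    · rw [if_pos (by omega), if_neg (by omega), if_neg hj0, if_neg hib,
        coeff_X_pow_mul_sub (e := n - k + (m - k) - (j + 1))
          (u := m + (n - k + (m - k) - (i + 1))) _ (by omega), apply_ite C, C_0]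

/-- Linear functionals may be applied to a subresultant inside the polynomial column. -/
theorem map_sres (m n k : ℕ) (hm : k ≤ m) (hn : k < n) (f g : K[X]) (L : K[X] →ₗ[K] K) :
    L (sres m n k f g) = (coeffMatrix (n - k + (m - k)) k (sylvesterRow (m - k) f g)
      fun i => L (sylvesterRow (m - k) f g i)).det := by
  rw [sres_eq_det_reverse m n k hm hn.le]
  obtain ⟨N, hN⟩ : ∃ N, n - k + (m - k) = N + 1 := ⟨n - k + (m - k) - 1, by omega⟩
  rw [hN, Matrix.det_succ_column_zero, Matrix.det_succ_column_zero, map_sum]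
  refine Finset.sum_congr rfl fun i _ => ?_
  have h : (Matrix.of fun i j : Fin (N + 1) =>
      if (j : ℕ) = 0 then sylvesterRow (m - k) f g i
      else C ((sylvesterRow (m - k) f g i).coeff (k + j))).submatrix i.succAbove Fin.succ =
      C.mapMatrix ((coeffMatrix (N + 1) k (sylvesterRow (m - k) f g)
        fun i => L (sylvesterRow (m - k) f g i)).submatrix i.succAbove Fin.succ) := by
    ext1 r c
    simp [coeffMatrix]
  rw [h, ← RingHom.map_det]
  have h1 : ∀ (P : K[X]) (c : K), L ((-1) ^ (i : ℕ) * P * C c) = (-1) ^ (i : ℕ) * L P * c := by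
    intro P c
    rw [show (-1 : K[X]) ^ (i : ℕ) * P * C c = ((-1) ^ (i : ℕ) * c) • P by
      rw [smul_eq_C_mul]; simp; ring, map_smul, smul_eq_mul]
    ring
  rw [h1]
  simp [coeffMatrix]

theorem coeff_sres (m n k : ℕ) (hm : k ≤ m) (hn : k < n) (f g : K[X]) (e : ℕ) :
    (sres m n k f g).coeff e = (coeffMatrix (n - k + (m - k)) k (sylvesterRow (m - k) f g)
      fun i => (sylvesterRow (m - k) f g i).coeff e).det :=
  map_sres m n k hm hn f g (lcoeff K e)

theorem natDegree_sylvesterRow_lt {f g : K[X]} {a b d i : ℕ} (hf : f.natDegree ≤ d + b)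
    (hg : g.natDegree ≤ d + a) (hi : i < a + b) :
    (sylvesterRow b f g i).natDegree < d + (a + b) := by
  rw [sylvesterRow]
  split_ifs with h
  · have := natDegree_mul_le (p := X ^ i) (q := g)
    rw [natDegree_X_pow] at this
    omega
  · have := natDegree_mul_le (p := X ^ (i - b)) (q := f)
    rw [natDegree_X_pow] at this
    omega

theorem degree_sres_le (m n k : ℕ) (hm : k ≤ m) (hn : k < n) {f g : K[X]}
    (hf : f.natDegree ≤ m) (hg : g.natDegree ≤ n) : (sres m n k f g).degree ≤ k := by
  refine (degree_le_iff_coeff_zero _ _).2 fun e he => ?_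
  have he : k < e := mod_cast he
  rw [coeff_sres m n k hm hn]
  by_cases h : e < k + (n - k + (m - k))
  · refine Matrix.det_zero_of_column_eq (i := ⟨0, by omega⟩) (j := ⟨e - k, by omega⟩) ?_ ?_
    · simp only [ne_eq, Fin.mk.injEq]
      omega
    · intro i
      simp [coeffMatrix, show e - k ≠ 0 by omega, show k + (e - k) = e by omega]
  · refine Matrix.det_eq_zero_of_column_eq_zero ⟨0, by omega⟩ fun i => ?_
    simp only [coeffMatrix, Matrix.of_apply, if_true]
    refine coeff_eq_zero_of_natDegree_lt ?_
    have := natDegree_sylvesterRow_lt (a := n - k) (b := m - k) (d := k) (i := i) (f := f) (g := g)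
      (by omega) (by omega) i.isLt
    omega

theorem sres_self (m n : ℕ) (h : m < n) {f : K[X]} (hf : f.Monic) (hd : f.natDegree = m)
    (g : K[X]) : sres m n m f g = f := by
  ext e
  rw [coeff_sres m n m le_rfl h, Matrix.det_of_isLowerTriangular]
  · obtain ⟨N, hN⟩ : ∃ N, n - m + (m - m) = N + 1 := ⟨n - m - 1, by omega⟩
    rw [hN, Fin.prod_univ_succ]
    have h1 : ∀ i : Fin N, (X ^ ((i : ℕ) + 1) * f).coeff (m + ((i : ℕ) + 1)) = 1 := by
      intro i
      rw [coeff_X_pow_mul, ← hd]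
      exact hf
    simp [coeffMatrix, sylvesterRow, h1]
  · intro i j hij
    have hij' : (i : ℕ) < j := hij
    simp only [coeffMatrix, Matrix.of_apply, sylvesterRow]
    rw [if_neg (by omega), if_neg (by omega)]
    refine coeff_eq_zero_of_natDegree_lt ?_
    have := natDegree_mul_le (p := X ^ ((i : ℕ) - (m - m))) (q := f)
    rw [natDegree_X_pow] at this
    omega

theorem det_coeffMatrix_X_sub_C_mul (N d : ℕ) (P : ℕ → K[X]) (α : K)
    (hP : ∀ i < N, (P i).natDegree < d + N) :
    (Matrix.of fun i j : Fin N => ((X - C α) * P i).coeff (d + 1 + j)).det =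
      (coeffMatrix N d P fun i => (P i).coeff d).det := by
  rcases N with _ | N
  · simp
  have h : ∀ (i : ℕ) (e : ℕ), ((X - C α) * P i).coeff (e + 1) =
      (P i).coeff e - α * (P i).coeff (e + 1) := by
    intro i e
    rw [sub_mul, coeff_sub, coeff_X_mul, coeff_C_mul]
  have h' : ∀ i j : Fin (N + 1), coeffMatrix (N + 1) d P (fun i => (P i).coeff d) i j =
      (P i).coeff (d + j) := by
    intro i j
    simp only [coeffMatrix, Matrix.of_apply]
    split_ifs with hj
    · rw [hj, add_zero]
    · rfl
  symm
  refine det_eq_of_forall_col_eq_smul_add_succ α (fun i => ?_) fun i j => ?_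
  · have h0 := coeff_eq_zero_of_natDegree_lt (hP i i.isLt)
    rw [h', Matrix.of_apply, add_right_comm, h]
    simp only [Fin.val_last]
    rw [add_assoc d N 1, h0, mul_zero, sub_zero]
  · rw [h', h', Matrix.of_apply, add_right_comm, h]
    simp only [Fin.val_castSucc, Fin.val_succ]
    rw [add_assoc d j 1]
    ring

/-- Removing a root `α` of `f` from a subresultant. -/
theorem eval_sres_X_sub_C_mul (m n k : ℕ) (hm : k ≤ m) (hn : k < n) {f g : K[X]}
    (hf : f.natDegree ≤ m) (hg : g.natDegree ≤ n) (α : K) :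
    (sres (m + 1) n k ((X - C α) * f) g).eval α = g.eval α * (sres m n k f g).coeff k := by
  have e := map_sres (m + 1) n k (by omega) hn ((X - C α) * f) g (leval α)
  rw [leval_apply] at e
  rw [e, coeff_sres m n k hm hn]
  obtain ⟨a, rfl⟩ : ∃ a, n = k + a := ⟨n - k, by omega⟩
  obtain ⟨b, rfl⟩ : ∃ b, m = k + b := ⟨m - k, by omega⟩
  rw [show k + a - k + (k + b + 1 - k) = a + b + 1 by omega, show k + b + 1 - k = b + 1 by omega,
    show k + a - k + (k + b - k) = a + b by omega, show k + b - k = b by omega]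
  rw [← det_coeffMatrix_X_sub_C_mul _ _ _ α fun i hi => natDegree_sylvesterRow_lt hf hg hi]
  have h0 : sylvesterRow (b + 1) ((X - C α) * f) g 0 = g := by simp [sylvesterRow]
  have hrow : ∀ i, sylvesterRow (b + 1) ((X - C α) * f) g (i + 1) =
      (X - C α) * sylvesterRow b f g i +
        C (if i < b then α else 0) * sylvesterRow (b + 1) ((X - C α) * f) g i := by
    intro i
    simp only [sylvesterRow]
    by_cases hi : i < b
    · rw [if_pos (by omega), if_pos hi, if_pos hi, if_pos (by omega)]
      ring
    · rw [if_neg (by omega), if_neg hi, if_neg hi, Nat.add_sub_add_right, C_0]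
      ring
  rw [Matrix.det_eq_of_forall_row_eq_smul_add_pred (fun i => if (i : ℕ) < b then α else 0)
    (B := Matrix.of (Fin.cons (fun j => coeffMatrix (a + b + 1) k
      (sylvesterRow (b + 1) ((X - C α) * f) g)
      (fun i => (sylvesterRow (b + 1) ((X - C α) * f) g i).eval α) 0 j)
      fun i j => if (j : ℕ) = 0 then 0 else ((X - C α) * sylvesterRow b f g i).coeff (k + j)))
    (fun j => by simp) fun i j => ?_]
  · rw [Matrix.det_succ_column_zero, Finset.sum_eq_single 0]
    · simp only [Fin.val_zero, pow_zero, one_mul, Matrix.of_apply, Fin.cons_zero, coeffMatrix,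
        if_true, h0]
      congr 2
      ext1 i j
      simp [add_assoc, add_comm 1]
    · intro i _ hi
      obtain ⟨i, rfl⟩ := Fin.exists_succ_eq.2 hi
      simp
    · simp
  · simp only [coeffMatrix, Matrix.of_apply, Fin.cons_succ, Fin.val_succ, Fin.val_castSucc, hrow,
      leval_apply]
    split_ifs <;> simp

end SubresultantMatrix

theorem doubleSum_eq_sres [DecidableEq K] {A B : Finset K} {p q a b : ℕ} (ha : 0 < a)
    (hA : #A = p + q + b) (hB : #B = p + q + a) :
    doubleSum p q A B = (-1 : K[X]) ^ (p * b) * ((p + q).choose p : K[X]) *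
      sres (p + q + b) (p + q + a) (p + q) (∏ x ∈ A, (X - C x)) (∏ x ∈ B, (X - C x)) := by
  have hdeg : ∀ S : Finset K, (∏ x ∈ S, (X - C x)).natDegree = #S := fun S =>
    natDegree_eq_of_degree_eq_some (degree_prod_X_sub_C S)
  induction b generalizing A with
  | zero =>
    have hm := (hdeg A).trans hA
    rw [add_zero] at hA hm ⊢
    rw [doubleSum_eq_choose_mul hA (by omega), sres_self _ _ (by omega)
      (monic_prod_of_monic _ _ fun x _ => monic_X_sub_C x) hm]
    simp
  | succ b ih =>
    have hc : ((-1 : K[X]) ^ (p * (b + 1)) * ((p + q).choose p : K[X])) =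
        C ((-1 : K) ^ (p * (b + 1)) * ((p + q).choose p : K)) := by simp
    have hlt : ((p + q : ℕ) : WithBot ℕ) < #A := by
      rw [hA]
      exact_mod_cast (by omega : p + q < p + q + (b + 1))
    refine eq_of_degrees_lt_of_eval_finset_eq A
      ((degree_doubleSum_le p q A B).trans_lt hlt) ?_ fun α hα => ?_
    · rw [hc, ← smul_eq_C_mul]
      refine ((degree_smul_le _ _).trans ?_).trans_lt hlt
      exact degree_sres_le _ _ _ (by omega) (by omega) ((hdeg A).trans hA).le
        ((hdeg B).trans hB).le
    · have hcard : #(A.erase α) = p + q + b := by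
        rw [Finset.card_erase_of_mem hα, hA]
        omega
      have e := eval_doubleSum_insert_left (Finset.notMem_erase α A) B p q
      rw [Finset.insert_erase hα, ← coeff_doubleSum, ih hcard] at e
      have hc' : ((-1 : K[X]) ^ (p * b) * ((p + q).choose p : K[X])) =
          C ((-1 : K) ^ (p * b) * ((p + q).choose p : K)) := by simp
      rw [hc', coeff_C_mul] at e
      rw [e, hc, eval_C_mul, ← Finset.mul_prod_erase A _ hα, ← add_assoc,
        eval_sres_X_sub_C_mul _ _ _ (by omega) (by omega) ((hdeg _).trans hcard).le
          ((hdeg B).trans hB).le, eval_prod]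
      simp only [eval_sub, eval_X, eval_C]
      ring

theorem sylvSum_eq_doubleSum [DecidableEq K] {m n : ℕ} (A : Fin m ↪ K) (B : Fin n ↪ K)
    (p q : ℕ) :
    sylvSum A B p q = doubleSum p q (univ.map A) (univ.map B) := by
  simp only [sylvSum, doubleSum, powersetCard_map, Finset.sum_map, RelEmbedding.coe_toEmbedding,
    mapEmbedding_apply, Finset.prod_map, doubleSumWeight, ← Finset.map_sdiff, crossProd,
    Finset.compl_eq_univ_sdiff]

/-- **Sylvester (case `0 ≤ d < m` or `d = m < n`)**: for `d := p+q` in this range,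
`Sylv^{p,q}(A,B;x) = (-1)^{p(m-d)}·C(d,p)·Sres_d(f,g)`. -/
theorem sylvSum_eq_sres {m n : ℕ} (hm : 1 ≤ m) (hn : 1 ≤ n) (hmn : m ≤ n)
    (A : Fin m → K) (B : Fin n → K) (hA : Function.Injective A) (hB : Function.Injective B)
    (f g : Polynomial K) (hf : f = ∏ i, (X - C (A i))) (hg : g = ∏ j, (X - C (B j)))
    (p q : ℕ) (hp : p ≤ m) (hq : q ≤ n)
    (hd : p + q < m ∨ (p + q = m ∧ m < n)) :
    sylvSum A B p q =
      (-1 : Polynomial K) ^ (p * (m - (p + q))) * ((p + q).choose p : Polynomial K) *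
        sres m n (p + q) f g := by
  classical
  have hcA : #(univ.map ⟨A, hA⟩) = p + q + (m - (p + q)) := by simp; omega
  have hcB : #(univ.map ⟨B, hB⟩) = p + q + (n - (p + q)) := by simp; omega
  have h := doubleSum_eq_sres (by omega) hcA hcB
  rw [← sylvSum_eq_doubleSum, Finset.prod_map, Finset.prod_map,
    show p + q + (m - (p + q)) = m by omega, show p + q + (n - (p + q)) = n by omega] at h
  subst hf hg
  exact h
end

section
/- Let 0 ≤ p ≤ m and 0 ≤ q ≤ n with d := p+q, and suppose m < d < n−1. Then Sylv^{p,q}(A,B;x) = 0. -/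
open Polynomial Finset

variable {K : Type*} [Field K]

theorem prod_sub_swap_s1 {ι L : Type*} [Field L] (b : ι → L) (S : Finset ι) (y : L) :
    ∏ i ∈ S, (y - b i) = (-1) ^ S.card * ∏ i ∈ S, (b i - y) := by
  rw [← Finset.prod_const, ← Finset.prod_mul_distrib]
  exact Finset.prod_congr rfl fun i _ => by ring

theorem sum_powersetCard_succ_insert {ι M : Type*} [DecidableEq ι] [AddCommMonoid M]
    {t : Finset ι} {a : ι} (ha : a ∉ t) (k : ℕ) (F : Finset ι → M) :
    ∑ S ∈ (insert a t).powersetCard (k + 1), F S =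
      ∑ S ∈ t.powersetCard (k + 1), F S + ∑ S ∈ t.powersetCard k, F (insert a S) := by
  have hmem : ∀ {r} {S : Finset ι}, S ∈ t.powersetCard r → a ∉ S := fun hS h =>
    ha ((Finset.mem_powersetCard.1 hS).1 h)
  rw [Finset.powersetCard_succ_insert ha, Finset.sum_union, Finset.sum_image]
  · intro S hS S' hS' h
    rw [← Finset.erase_insert (hmem hS), ← Finset.erase_insert (hmem hS'), h]
  · rw [Finset.disjoint_left]
    intro S hS hS'
    obtain ⟨S', -, rfl⟩ := Finset.mem_image.1 hS'
    exact hmem hS (Finset.mem_insert_self _ _)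

/-- The weight `∏_{i ∈ S} u(b_i) ∏_{j ∈ t ∖ S} v(b_j) / ∏_{i ∈ S, j ∈ t ∖ S} (b_i - b_j)`. -/
noncomputable def splitWeight {ι L : Type*} [DecidableEq ι] [Field L] (b : ι → L)
    (u v : Polynomial L) (t S : Finset ι) : L :=
  (∏ i ∈ S, u.eval (b i)) * (∏ j ∈ t \ S, v.eval (b j)) /
    ∏ i ∈ S, ∏ j ∈ t \ S, (b i - b j)

section SplitWeight

variable {ι L : Type*} [DecidableEq ι] [Field L] (b : ι → L) (u v : Polynomial L)

theorem splitWeight_insert_right {t S : Finset ι} {a : ι} (ha : a ∉ t) (hS : S ⊆ t) :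
    splitWeight b u v (insert a t) S =
      splitWeight b u v t S * v.eval (b a) / ∏ i ∈ S, (b i - b a) := by
  have haS : a ∉ S := fun h => ha (hS h)
  have hat : a ∉ t \ S := fun h => ha (Finset.mem_sdiff.1 h).1
  rw [splitWeight, splitWeight, Finset.insert_sdiff_of_notMem _ haS, Finset.prod_insert hat]
  simp_rw [Finset.prod_insert hat]
  rw [Finset.prod_mul_distrib]
  simp only [div_eq_mul_inv, mul_inv]
  ring

theorem splitWeight_insert_insert {t S : Finset ι} {a : ι} (ha : a ∉ t) (hS : S ⊆ t) :
    splitWeight b u v (insert a t) (insert a S) =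
      splitWeight b u v t S * u.eval (b a) / ∏ j ∈ t \ S, (b a - b j) := by
  have haS : a ∉ S := fun h => ha (hS h)
  rw [splitWeight, splitWeight, Finset.insert_sdiff_insert, Finset.sdiff_insert_of_notMem ha,
    Finset.prod_insert haS, Finset.prod_insert haS]
  simp only [div_eq_mul_inv, mul_inv]
  ring

/-- The sum of the weights of the `(k+1)`-subsets of `insert a t`, after clearing the
denominators that involve `b a` and replacing `b a` by the indeterminate. -/
noncomputable def splitPoly (t : Finset ι) (k : ℕ) : Polynomial L :=
  u * ∑ S ∈ t.powersetCard k, C (splitWeight b u v t S) * ∏ i ∈ S, (X - C (b i)) +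
    (-1) ^ (k + 1) *
      (v * ∑ S ∈ t.powersetCard (k + 1), C (splitWeight b u v t S) *
        ∏ j ∈ t \ S, (X - C (b j)))

theorem eval_splitPoly (t : Finset ι) (k : ℕ) (y : L) :
    (splitPoly b u v t k).eval y =
      ∑ S ∈ t.powersetCard k, u.eval y * (splitWeight b u v t S * ∏ i ∈ S, (y - b i)) +
      ∑ S ∈ t.powersetCard (k + 1), (-1) ^ (k + 1) *
        (v.eval y * (splitWeight b u v t S * ∏ j ∈ t \ S, (y - b j))) := by
  simp [splitPoly, eval_finsetSum, eval_prod, Finset.mul_sum]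

theorem degree_splitPoly_lt {t : Finset ι} {k : ℕ} (hu : u.natDegree + k < t.card)
    (hv : v.natDegree ≤ k) : (splitPoly b u v t k).degree < t.card := by
  have key : ∀ (w : Polynomial L) (r d : ℕ) (T : Finset ι → Finset ι),
      (∀ S ∈ t.powersetCard r, (T S).card = d) → w.natDegree + d < t.card →
      (w * ∑ S ∈ t.powersetCard r, C (splitWeight b u v t S) *
        ∏ i ∈ T S, (X - C (b i))).degree < t.card := by
    intro w r d T hT hw
    refine (degree_mul_le _ _).trans_lt
      ((add_le_add degree_le_natDegree (degree_sum_le _ _)).trans_lt ?_)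
    have hsup : ((t.powersetCard r).sup fun S =>
        (C (splitWeight b u v t S) * ∏ i ∈ T S, (X - C (b i))).degree) ≤ (d : WithBot ℕ) := by
      refine Finset.sup_le fun S hS => ?_
      refine (degree_mul_le _ _).trans ((add_le_add degree_C_le le_rfl).trans ?_)
      rw [zero_add, degree_prod]
      simp [hT S hS]
    refine (add_le_add le_rfl hsup).trans_lt ?_
    exact_mod_cast hw
  refine (degree_add_le _ _).trans_lt (max_lt ?_ ?_)
  · exact key u k k id (fun S hS => (Finset.mem_powersetCard.1 hS).2) hu
  · have h := key v (k + 1) (t.card - (k + 1)) (fun S => t \ S) (fun S hS => by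
      rw [Finset.mem_powersetCard] at hS
      rw [Finset.card_sdiff_of_subset hS.1, hS.2]) (by omega)
    rcases neg_one_pow_eq_or (Polynomial L) (k + 1) with e | e
    · rwa [e, one_mul]
    · rwa [e, neg_one_mul, degree_neg]

theorem eval_splitPoly_of_mem {t : Finset ι} (hb : Set.InjOn b t) (k : ℕ) {a : ι}
    (ha : a ∈ t) : (splitPoly b u v t k).eval (b a) = 0 := by
  obtain ⟨s, has, rfl⟩ : ∃ s, a ∉ s ∧ insert a s = t :=
    ⟨t.erase a, Finset.notMem_erase _ _, Finset.insert_erase ha⟩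
  have hne : ∀ i ∈ s, b a - b i ≠ 0 := fun i hi h => has <| by
    rw [hb (Finset.mem_insert_self _ _) (Finset.mem_insert_of_mem hi) (sub_eq_zero.1 h)]
    exact hi
  have first : ∑ S ∈ (insert a s).powersetCard k, u.eval (b a) *
        (splitWeight b u v (insert a s) S * ∏ i ∈ S, (b a - b i)) =
      ∑ S ∈ s.powersetCard k, u.eval (b a) *
        (splitWeight b u v (insert a s) S * ∏ i ∈ S, (b a - b i)) := by
    symm
    refine Finset.sum_subset (Finset.powersetCard_mono (Finset.subset_insert _ _)) ?_
    intro S hS hS'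
    rw [Finset.mem_powersetCard] at hS hS'
    have haS : a ∈ S := by
      by_contra h
      exact hS' ⟨(Finset.subset_insert_iff_of_notMem h).1 hS.1, hS.2⟩
    rw [Finset.prod_eq_zero haS (sub_self _), mul_zero, mul_zero]
  rw [eval_splitPoly, first, sum_powersetCard_succ_insert has,
    Finset.sum_eq_zero (s := s.powersetCard (k + 1)), zero_add, ← Finset.sum_add_distrib]
  · refine Finset.sum_eq_zero fun S hS => ?_
    rw [Finset.mem_powersetCard] at hS
    rw [splitWeight_insert_right b u v has hS.1, splitWeight_insert_insert b u v has hS.1,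
      Finset.insert_sdiff_insert, Finset.sdiff_insert_of_notMem has, prod_sub_swap_s1 b S, hS.2]
    have h1 : ∏ i ∈ S, (b i - b a) ≠ 0 := Finset.prod_ne_zero_iff.2 fun i hi h =>
      hne i (hS.1 hi) (by rw [← neg_sub, h, neg_zero])
    have h2 : ∏ j ∈ s \ S, (b a - b j) ≠ 0 := Finset.prod_ne_zero_iff.2 fun i hi =>
      hne i (Finset.mem_sdiff.1 hi).1
    field_simp
    ring
  · intro S hS
    have haS : a ∈ insert a s \ S := Finset.mem_sdiff.2 ⟨Finset.mem_insert_self _ _,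
      fun h => has ((Finset.mem_powersetCard.1 hS).1 h)⟩
    rw [Finset.prod_eq_zero haS (sub_self _)]
    simp

theorem sum_splitWeight_insert_mul {t : Finset ι} {a : ι} (ha : a ∉ t)
    (hne : ∀ i ∈ t, b a - b i ≠ 0) (k : ℕ) :
    (∑ S ∈ (insert a t).powersetCard (k + 1), splitWeight b u v (insert a t) S) *
      ∏ i ∈ t, (b a - b i) = (splitPoly b u v t k).eval (b a) := by
  rw [eval_splitPoly, sum_powersetCard_succ_insert ha, add_comm, add_mul, Finset.sum_mul, Finset.sum_mul]
  congr 1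
  · refine Finset.sum_congr rfl fun S hS => ?_
    rw [Finset.mem_powersetCard] at hS
    have h2 : ∏ j ∈ t \ S, (b a - b j) ≠ 0 := Finset.prod_ne_zero_iff.2 fun i hi =>
      hne i (Finset.mem_sdiff.1 hi).1
    rw [splitWeight_insert_insert b u v ha hS.1, ← Finset.prod_sdiff hS.1]
    field_simp
  · refine Finset.sum_congr rfl fun S hS => ?_
    rw [Finset.mem_powersetCard] at hS
    have h1 : ∏ i ∈ S, (b i - b a) ≠ 0 := Finset.prod_ne_zero_iff.2 fun i hi h =>
      hne i (hS.1 hi) (by rw [← neg_sub, h, neg_zero])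
    rw [splitWeight_insert_right b u v ha hS.1, ← Finset.prod_sdiff hS.1,
      prod_sub_swap_s1 b S, hS.2]
    field_simp

/-- The symmetrized sum of `∏ u ∏ v / ∏ (b_i - b_j)` over the `q`-subsets of `t` vanishes when
the degrees of `u` and `v` are small. -/
theorem sum_splitWeight_eq_zero {t : Finset ι} (hb : Set.InjOn b t) {q : ℕ}
    (hu : u.natDegree + q < t.card) (hv : v.natDegree < q) :
    ∑ S ∈ t.powersetCard q, splitWeight b u v t S = 0 := by
  obtain ⟨k, rfl⟩ : ∃ k, q = k + 1 := ⟨q - 1, by omega⟩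
  obtain ⟨a, hat⟩ : t.Nonempty := Finset.card_pos.1 (by omega)
  obtain ⟨s, has, rfl⟩ : ∃ s, a ∉ s ∧ insert a s = t :=
    ⟨t.erase a, Finset.notMem_erase _ _, Finset.insert_erase hat⟩
  have hne : ∀ i ∈ s, b a - b i ≠ 0 := fun i hi h => has <| by
    rw [hb hat (Finset.mem_insert_of_mem hi) (sub_eq_zero.1 h)]
    exact hi
  rw [Finset.card_insert_of_notMem has] at hu
  have hbs : Set.InjOn b s := hb.mono (by simp)
  have hzero : splitPoly b u v s k = 0 :=
    eq_zero_of_degree_lt_of_eval_index_eq_zero (v := b) (s := s) hbs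
      (degree_splitPoly_lt b u v (by omega) (by omega))
      fun i hi => eval_splitPoly_of_mem b u v hbs k hi
  have h := sum_splitWeight_insert_mul b u v has hne k
  rw [hzero, eval_zero] at h
  exact (mul_eq_zero.1 h).resolve_right (Finset.prod_ne_zero_iff.2 hne)

end SplitWeight

theorem natDegree_prod_C_sub_X_le {ι L : Type*} [Field L] (a : ι → L) (S : Finset ι) :
    (∏ i ∈ S, (C (a i) - X)).natDegree ≤ S.card := by
  refine (natDegree_prod_le _ _).trans ?_
  rw [Finset.card_eq_sum_ones]
  refine Finset.sum_le_sum fun i _ => ?_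
  exact (natDegree_sub_le _ _).trans (by simp)

/-- **Sylvester (case `m < d < n-1`)**: `Sylv^{p,q}(A,B;x) = 0`. -/
theorem sylvSum_eq_zero {m n : ℕ} (hm : 1 ≤ m) (hn : 1 ≤ n) (hmn : m ≤ n)
    (A : Fin m → K) (B : Fin n → K) (hA : Function.Injective A) (hB : Function.Injective B)
    (f g : Polynomial K) (hf : f = ∏ i, (X - C (A i))) (hg : g = ∏ j, (X - C (B j)))
    (p q : ℕ) (hp : p ≤ m) (hq : q ≤ n)
    (hd1 : m < p + q) (hd2 : p + q + 1 < n) :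
    sylvSum A B p q = 0 := by
  have hφ := RatFunc.algebraMap_injective K
  set φ : Polynomial K →+* RatFunc K := algebraMap (Polynomial K) (RatFunc K)
  set ψ : K →+* RatFunc K := φ.comp C
  have hψC : ∀ a, φ (C a) = ψ a := fun _ => rfl
  apply hφ
  rw [map_zero, sylvSum, map_sum]
  refine Finset.sum_eq_zero fun Sa hSa => ?_
  have hcard : Sa.card = p := (Finset.mem_powersetCard.1 hSa).2
  have hcard' : Saᶜ.card = m - p := by rw [Finset.card_compl, hcard, Fintype.card_fin]
  set u : Polynomial (RatFunc K) := (C (φ X) - X) * ∏ i ∈ Sa, (C (ψ (A i)) - X) with hu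
  set v : Polynomial (RatFunc K) := ∏ i ∈ Saᶜ, (C (ψ (A i)) - X) with hv
  have hvdeg : v.natDegree ≤ m - p :=
    hcard' ▸ natDegree_prod_C_sub_X_le (fun i => ψ (A i)) Saᶜ
  have hudeg : u.natDegree ≤ 1 + p := by
    refine natDegree_mul_le.trans (add_le_add ?_ ?_)
    · exact (natDegree_sub_le _ _).trans (by simp)
    · exact hcard ▸ natDegree_prod_C_sub_X_le (fun i => ψ (A i)) Sa
  have hsum := sum_splitWeight_eq_zero (fun j => ψ (B j)) u v (t := Finset.univ)
    (ψ.injective.comp hB).injOn (q := q)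
    (by rw [Finset.card_univ, Fintype.card_fin]; omega) (by omega)
  rw [map_sum, ← mul_zero ((∏ i ∈ Sa, φ (X - C (A i))) /
    ∏ i ∈ Sa, ∏ i' ∈ Saᶜ, (ψ (A i) - ψ (A i'))), ← hsum, Finset.mul_sum]
  refine Finset.sum_congr rfl fun Sb _ => ?_
  have hU : ∏ j ∈ Sb, u.eval (ψ (B j)) =
      (∏ j ∈ Sb, (φ X - ψ (B j))) * ∏ i ∈ Sa, ∏ j ∈ Sb, (ψ (A i) - ψ (B j)) := by
    rw [Finset.prod_comm (s := Sa), ← Finset.prod_mul_distrib]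
    simp [hu, eval_prod]
  have hV : ∏ j ∈ Sbᶜ, v.eval (ψ (B j)) =
      ∏ i ∈ Saᶜ, ∏ j ∈ Sbᶜ, (ψ (A i) - ψ (B j)) := by
    rw [Finset.prod_comm (s := Saᶜ)]
    simp [hv, eval_prod]
  rw [splitWeight, ← Finset.compl_eq_univ_sdiff, hU, hV]
  simp only [map_mul, map_prod, map_sub, hψC, map_div₀]
  simp only [div_eq_mul_inv, mul_inv]
  ring
end

section
/- Let 0 ≤ p ≤ m and 0 ≤ q ≤ n with d := p+q, and suppose m < d = n−1. Then Sylv^{p,q}(A,B;x) = (−1)^{(m+q)(p+1)} · binomial(m,p) · f(x). -/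
open Polynomial Finset

variable {K : Type*} [Field K]

/-- Swapping the two families in a double product of differences yields a sign. -/
theorem prod_prod_sub_swap {R ι κ : Type*} [CommRing R] (s : Finset ι) (t : Finset κ)
    (a : ι → R) (b : κ → R) :
    ∏ i ∈ s, ∏ j ∈ t, (a i - b j) =
      (-1) ^ (s.card * t.card) * ∏ j ∈ t, ∏ i ∈ s, (b j - a i) := by
  have h : ∀ i ∈ s, ∏ j ∈ t, (a i - b j) = (-1) ^ t.card * ∏ j ∈ t, (b j - a i) := by
    intro i _
    rw [← Finset.prod_const, ← Finset.prod_mul_distrib]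
    exact Finset.prod_congr rfl fun j _ => by ring
  rw [Finset.prod_congr rfl h, Finset.prod_mul_distrib, Finset.prod_const, ← pow_mul,
    Finset.prod_comm, mul_comm t.card]

/-- Lagrange interpolation, evaluated at a point of a commutative algebra. -/
theorem aeval_eq_sum_lagrange {F R ι : Type*} [Field F] [CommRing R] [Algebra F R]
    [DecidableEq ι] {T : Finset ι} {v : ι → F} (hv : Set.InjOn v T) {P : Polynomial F}
    (hP : P.natDegree < T.card) (y : R) :
    aeval y P =
      ∑ b ∈ T, aeval y (Lagrange.basis T v b) * algebraMap F R (P.eval (v b)) := by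
  have hdeg : P.degree < (T.card : WithBot ℕ) :=
    lt_of_le_of_lt degree_le_natDegree (by exact_mod_cast hP)
  conv_lhs => rw [Lagrange.eq_interpolate hv hdeg, Lagrange.interpolate_apply, map_sum]
  refine Finset.sum_congr rfl fun b _ => ?_
  rw [map_mul, aeval_C, mul_comm]

/-- Symmetric Lagrange interpolation for the symmetric function `∏ y ∈ Y, h y`. -/
theorem sum_powersetCard_symmetric_interpolation {F R ι : Type*} [Field F] [CommRing R]
    [Algebra F R] [DecidableEq ι] {v : ι → F} {q : ℕ} {h : Polynomial F}
    (hh : h.natDegree ≤ q) (Y : Multiset R) :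
    ∀ T : Finset ι, Set.InjOn v T → T.card = q + Y.card →
      ∑ S ∈ T.powersetCard q,
        (Y.map fun y => ∏ i ∈ S, (y - algebraMap F R (v i))).prod *
          algebraMap F R
            ((∏ j ∈ T \ S, h.eval (v j)) / ∏ j ∈ T \ S, ∏ i ∈ S, (v j - v i)) =
        (Y.map fun y => aeval y h).prod := by
  induction Y using Multiset.induction_on with
  | empty =>
    intro T _ hT
    obtain rfl : T.card = q := by simpa using hT
    simp
  | cons y Y ih =>
    intro T hv hT
    rw [Multiset.card_cons] at hT
    rw [Multiset.map_cons, Multiset.prod_cons, aeval_eq_sum_lagrange hv (by omega) y,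
      Finset.sum_mul]
    have hb : ∀ b ∈ T,
        aeval y (Lagrange.basis T v b) * algebraMap F R (h.eval (v b)) *
          (Y.map fun y => aeval y h).prod =
        ∑ S ∈ (T.erase b).powersetCard q,
          aeval y (Lagrange.basis T v b) * algebraMap F R (∏ i ∈ S, (v b - v i)) *
          ((Y.map fun y => ∏ i ∈ S, (y - algebraMap F R (v i))).prod *
          algebraMap F R
            ((∏ j ∈ T \ S, h.eval (v j)) / ∏ j ∈ T \ S, ∏ i ∈ S, (v j - v i))) := by
      intro b hbT
      rw [← ih (T.erase b) (hv.mono (by simp))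
        (by rw [Finset.card_erase_of_mem hbT]; omega), Finset.mul_sum]
      refine Finset.sum_congr rfl fun S hS => ?_
      obtain ⟨hST, -⟩ := Finset.mem_powersetCard.1 hS
      have hbS : b ∉ S := fun hb => Finset.notMem_erase b T (hST hb)
      have hmem : b ∈ T \ S := Finset.mem_sdiff.2 ⟨hbT, hbS⟩
      have hne : ∏ i ∈ S, (v b - v i) ≠ 0 := by
        refine Finset.prod_ne_zero_iff.2 fun i hi => sub_ne_zero.2 fun e => ?_
        exact hbS (hv hbT (Finset.mem_of_mem_erase (hST hi)) e ▸ hi)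
      rw [Finset.erase_sdiff_comm, ← Finset.mul_prod_erase _ _ hmem,
        ← Finset.mul_prod_erase (T \ S) (fun j => ∏ i ∈ S, (v j - v i)) hmem]
      have hcancel : ∀ x d e : F, e ≠ 0 →
          h.eval (v b) * (x / d) = e * (h.eval (v b) * x / (e * d)) := by
        intro x d e he
        rw [mul_div_assoc', mul_div_assoc', mul_div_mul_left _ _ he]
      have hmap := congrArg (algebraMap F R) (hcancel (∏ j ∈ (T \ S).erase b, h.eval (v j))
        (∏ j ∈ (T \ S).erase b, ∏ i ∈ S, (v j - v i)) _ hne)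
      rw [map_mul, map_mul] at hmap
      linear_combination (aeval y (Lagrange.basis T v b) *
        (Y.map fun y => ∏ i ∈ S, (y - algebraMap F R (v i))).prod) * hmap
    rw [Finset.sum_congr rfl hb, Finset.sum_comm'
      (t' := T.powersetCard q) (s' := fun S => T \ S)]
    · refine Finset.sum_congr rfl fun S hS => ?_
      obtain ⟨hST, hSq⟩ := Finset.mem_powersetCard.1 hS
      rw [← Finset.sum_mul, Multiset.map_cons, Multiset.prod_cons, mul_assoc]
      congr 1
      have hP : (∏ i ∈ S, (X - C (v i)) : Polynomial F).natDegree < T.card := by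
        rw [natDegree_prod_of_monic _ _ fun i _ => monic_X_sub_C _]
        simp only [natDegree_X_sub_C, Finset.sum_const, smul_eq_mul, mul_one]
        omega
      have hL := aeval_eq_sum_lagrange hv hP y
      simp only [map_prod, map_sub, aeval_X, aeval_C, eval_prod, eval_sub, eval_X,
        eval_C] at hL
      rw [hL]
      simp only [map_prod, map_sub]
      symm
      refine Finset.sum_subset Finset.sdiff_subset fun b hbT hb => ?_
      have hbS : b ∈ S := by
        by_contra hbS
        exact hb (Finset.mem_sdiff.2 ⟨hbT, hbS⟩)
      rw [Finset.prod_eq_zero hbS (sub_self _), mul_zero]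
    · intro b S
      simp only [Finset.mem_powersetCard, Finset.mem_sdiff, Finset.subset_erase]
      tauto

/-- The inner sum of Sylvester's double sum, for a fixed subset `Sa`, when `p + q + 1 = n`. -/
theorem sum_powersetCard_sylv_inner {m n : ℕ} (A : Fin m → K) (B : Fin n → K)
    (hB : Function.Injective B) {p q : ℕ} (hd1 : m ≤ p + q) (hd2 : p + q + 1 = n)
    {Sa : Finset (Fin m)} (hSa : Sa.card = p) :
    ∑ Sb ∈ Finset.powersetCard q (Finset.univ : Finset (Fin n)),
      (∏ j ∈ Sb, (X - C (B j))) *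
        C (((∏ i ∈ Sa, ∏ j ∈ Sb, (A i - B j)) *
            (∏ i ∈ Saᶜ, ∏ j ∈ Sbᶜ, (A i - B j))) /
            ∏ j ∈ Sb, ∏ j' ∈ Sbᶜ, (B j - B j')) =
      (-1) ^ ((m + q) * (p + 1)) * (∏ i ∈ Saᶜ, (X - C (A i))) *
        C (∏ i ∈ Sa, ∏ i' ∈ Saᶜ, (A i - A i')) := by
  have hpm : p ≤ m := by simpa [hSa] using Finset.card_le_univ Sa
  have hcard : Saᶜ.card = m - p := by rw [Finset.card_compl, hSa, Fintype.card_fin]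
  have hdeg : (∏ i ∈ Saᶜ, (C (A i) - X) : Polynomial K).natDegree ≤ q := by
    refine (natDegree_prod_le _ _).trans ?_
    calc ∑ i ∈ Saᶜ, (C (A i) - X : Polynomial K).natDegree
        ≤ ∑ _i ∈ Saᶜ, 1 := Finset.sum_le_sum fun i _ => by
          rw [← neg_sub, natDegree_neg, natDegree_X_sub_C]
      _ ≤ q := by
          rw [Finset.sum_const, smul_eq_mul, mul_one, hcard]
          omega
  have key := sum_powersetCard_symmetric_interpolation (R := Polynomial K) (v := B) hdeg
    (X ::ₘ Sa.val.map fun i => C (A i)) Finset.univ hB.injOn (by simp [hSa]; omega)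
  simp only [Multiset.map_cons, Multiset.prod_cons, Multiset.map_map, Function.comp_def,
    ← Polynomial.C_eq_algebraMap, Finset.prod_map_val, eval_prod, eval_sub, eval_C, eval_X,
    map_prod (aeval _), map_sub (aeval _), aeval_C, aeval_X, ← Finset.compl_eq_univ_sdiff] at key
  have hneg : (∏ i ∈ Saᶜ, (C (A i) - X) : Polynomial K) =
      (-1) ^ (m - p) * ∏ i ∈ Saᶜ, (X - C (A i)) := by
    rw [← hcard, ← Finset.prod_const, ← Finset.prod_mul_distrib]
    exact Finset.prod_congr rfl fun j _ => by ring
  have hswap : (∏ i ∈ Sa, ∏ i' ∈ Saᶜ, (C (A i') - C (A i)) : Polynomial K) =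
      (-1) ^ (p * (m - p)) * C (∏ i ∈ Sa, ∏ i' ∈ Saᶜ, (A i - A i')) := by
    rw [Finset.prod_comm, prod_prod_sub_swap, hcard, hSa, mul_comm p]
    simp only [map_prod, map_sub]
  have hsign : (-1 : Polynomial K) ^ ((m + q) * (p + 1)) =
      (-1) ^ (q * (p + 1)) * ((-1) ^ (m - p) * (-1) ^ (p * (m - p))) := by
    obtain ⟨r, rfl⟩ := Nat.exists_eq_add_of_le hpm
    rw [Nat.add_sub_cancel_left, ← pow_add, ← pow_add,
      show (p + r + q) * (p + 1) = p * (p + 1) + (q * (p + 1) + (r + p * r)) by ring,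
      pow_add, (Nat.even_mul_succ_self p).neg_one_pow, one_mul]
  rw [hneg, hswap] at key
  rw [hsign]
  trans (-1) ^ (q * (p + 1)) * ((-1) ^ (m - p) * (∏ i ∈ Saᶜ, (X - C (A i))) *
    ((-1) ^ (p * (m - p)) * C (∏ i ∈ Sa, ∏ i' ∈ Saᶜ, (A i - A i'))))
  swap
  · ring
  rw [← key, Finset.mul_sum]
  refine Finset.sum_congr rfl fun Sb hSb => ?_
  obtain ⟨-, hSbq⟩ := Finset.mem_powersetCard.1 hSb
  have hSbc : Sbᶜ.card = p + 1 := by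
    rw [Finset.card_compl, hSbq, Fintype.card_fin]
    omega
  rw [prod_prod_sub_swap Sb Sbᶜ B B, hSbq, hSbc, Finset.prod_comm (s := Saᶜ)]
  have hinv : ((-1 : K) ^ (q * (p + 1)))⁻¹ = (-1) ^ (q * (p + 1)) := by
    rw [← inv_pow, inv_neg_one]
  rw [div_eq_mul_inv, mul_inv, hinv, div_eq_mul_inv]
  simp only [map_mul, map_prod, map_sub, map_pow, map_neg, map_one]
  ring

/-- **Sylvester (case `m < d = n-1`)**:
`Sylv^{p,q}(A,B;x) = (-1)^{(m+q)(p+1)}·C(m,p)·f(x)`. -/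
theorem sylvSum_eq_mul_f {m n : ℕ} (hm : 1 ≤ m) (hn : 1 ≤ n) (hmn : m ≤ n)
    (A : Fin m → K) (B : Fin n → K) (hA : Function.Injective A) (hB : Function.Injective B)
    (f g : Polynomial K) (hf : f = ∏ i, (X - C (A i))) (hg : g = ∏ j, (X - C (B j)))
    (p q : ℕ) (hp : p ≤ m) (hq : q ≤ n)
    (hd1 : m < p + q) (hd2 : p + q + 1 = n) :
    sylvSum A B p q =
      (-1 : Polynomial K) ^ ((m + q) * (p + 1)) * (m.choose p : Polynomial K) * f := by
  have hterm : ∀ Sa ∈ Finset.powersetCard p (Finset.univ : Finset (Fin m)),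
      ∑ Sb ∈ Finset.powersetCard q (Finset.univ : Finset (Fin n)),
        (∏ i ∈ Sa, (X - C (A i))) * (∏ j ∈ Sb, (X - C (B j))) *
          C (((∏ i ∈ Sa, ∏ j ∈ Sb, (A i - B j)) *
              (∏ i ∈ Saᶜ, ∏ j ∈ Sbᶜ, (A i - B j))) /
             ((∏ i ∈ Sa, ∏ i' ∈ Saᶜ, (A i - A i')) *
              (∏ j ∈ Sb, ∏ j' ∈ Sbᶜ, (B j - B j')))) =
        (-1) ^ ((m + q) * (p + 1)) * f := by
    intro Sa hSa
    obtain ⟨-, hSap⟩ := Finset.mem_powersetCard.1 hSa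
    have hne : ∏ i ∈ Sa, ∏ i' ∈ Saᶜ, (A i - A i') ≠ 0 := by
      refine Finset.prod_ne_zero_iff.2 fun i hi => Finset.prod_ne_zero_iff.2 fun i' hi' => ?_
      exact sub_ne_zero.2 fun e => Finset.mem_compl.1 hi' (hA e ▸ hi)
    have hinner := sum_powersetCard_sylv_inner A B hB hd1.le hd2 hSap
    set D := ∏ i ∈ Sa, ∏ i' ∈ Saᶜ, (A i - A i')
    have hD : C D * C D⁻¹ = 1 := by rw [← C_mul, mul_inv_cancel₀ hne, C_1]
    rw [hf, ← Finset.prod_mul_prod_compl Sa fun i => X - C (A i)]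
    trans (∏ i ∈ Sa, (X - C (A i))) * C D⁻¹ * ((-1) ^ ((m + q) * (p + 1)) *
      (∏ i ∈ Saᶜ, (X - C (A i))) * C D)
    · rw [← hinner, Finset.mul_sum]
      refine Finset.sum_congr rfl fun Sb _ => ?_
      rw [div_mul_eq_div_div_swap, div_eq_mul_inv _ D, C_mul]
      ring
    · linear_combination ((-1) ^ ((m + q) * (p + 1)) * (∏ i ∈ Sa, (X - C (A i))) *
        ∏ i ∈ Saᶜ, (X - C (A i))) * hD
  rw [sylvSum, Finset.sum_congr rfl hterm, Finset.sum_const, Finset.card_powersetCard,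
    Finset.card_univ, Fintype.card_fin, nsmul_eq_mul]
  ring
end

section
/- Let 0 ≤ p ≤ m and 0 ≤ q ≤ n with d := p+q, and suppose n ≤ d ≤ m+n−1. Set k := m+n−d−1 and σ := q(m−p)+n(d−m)+d+n−q−1. Then Sylv^{p,q}(A,B;x) = (−1)^{σ} · ( binomial(k,m−p)·F_k(x)·f(x) − binomial(k,n−q)·G_k(x)·g(x) ) in K[x]. -/
open Polynomial Finset

variable {K : Type*} [Field K]

/-- The determinant of the `N`-square matrix with entries `φ i j` for `i, j < N`. -/
noncomputable def natDet {R : Type*} [CommRing R] (N : ℕ) (φ : ℕ → ℕ → R) : R :=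
  (Matrix.of fun i j : Fin N => φ i j).det

section NatDet

variable {R : Type*} [CommRing R]

theorem natDet_congr {N : ℕ} {φ ψ : ℕ → ℕ → R} (h : ∀ i < N, ∀ j < N, φ i j = ψ i j) :
    natDet N φ = natDet N ψ := by
  unfold natDet
  congr 1
  ext i j
  exact h i i.2 j j.2

theorem map_natDet {S : Type*} [CommRing S] (θ : R →+* S) (N : ℕ) (φ : ℕ → ℕ → R) :
    θ (natDet N φ) = natDet N fun i j => θ (φ i j) := by
  unfold natDet
  rw [RingHom.map_det]
  rfl

theorem natDet_transpose (N : ℕ) (φ : ℕ → ℕ → R) :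
    natDet N (fun i j => φ j i) = natDet N φ := by
  unfold natDet
  rw [← Matrix.det_transpose]
  rfl

theorem natDet_mul (N : ℕ) (φ ψ : ℕ → ℕ → R) :
    natDet N φ * natDet N ψ = natDet N fun i j => ∑ l ∈ range N, φ i l * ψ l j := by
  unfold natDet
  rw [← Matrix.det_mul]
  congr 1
  ext i j
  simp [Matrix.mul_apply, Finset.sum_range]

theorem natDet_upper {N : ℕ} {φ : ℕ → ℕ → R} (h : ∀ i < N, ∀ j < i, φ i j = 0)
    (h1 : ∀ i < N, φ i i = 1) : natDet N φ = 1 := by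
  unfold natDet
  rw [Matrix.det_of_isUpperTriangular]
  · exact Finset.prod_eq_one fun i _ => h1 i i.2
  · intro i j hij
    exact h i i.2 j hij

theorem natDet_lower {N : ℕ} {φ : ℕ → ℕ → R} (h : ∀ j < N, ∀ i < j, φ i j = 0)
    (h1 : ∀ i < N, φ i i = 1) : natDet N φ = 1 := by
  rw [← natDet_transpose]
  exact natDet_upper h h1

theorem natDet_mul_row (N : ℕ) (c : ℕ → R) (φ : ℕ → ℕ → R) :
    natDet N (fun i j => c i * φ i j) = (∏ i ∈ range N, c i) * natDet N φ := by
  unfold natDet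
  rw [Finset.prod_range, ← Matrix.det_mul_column]
  rfl

theorem natDet_mul_col (N : ℕ) (c : ℕ → R) (φ : ℕ → ℕ → R) :
    natDet N (fun i j => c j * φ i j) = (∏ i ∈ range N, c i) * natDet N φ := by
  unfold natDet
  rw [Finset.prod_range, ← Matrix.det_mul_row]
  rfl

theorem natDet_block_lower (a b : ℕ) (φ : ℕ → ℕ → R)
    (h : ∀ i < a, ∀ j < b, φ i (a + j) = 0) :
    natDet (a + b) φ = natDet a φ * natDet b fun i j => φ (a + i) (a + j) := by
  unfold natDet
  rw [← Matrix.det_fromBlocks_zero₁₂ _ (Matrix.of fun (i : Fin b) (j : Fin a) => φ (a + i) j),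
    ← Matrix.det_submatrix_equiv_self (finSumFinEquiv (m := a) (n := b))]
  congr 1
  ext i j
  rcases i with i | i <;> rcases j with j | j <;> simp
  exact h i i.2 j j.2

theorem natDet_block_upper (a b : ℕ) (φ : ℕ → ℕ → R)
    (h : ∀ i < b, ∀ j < a, φ (a + i) j = 0) :
    natDet (a + b) φ = natDet a φ * natDet b fun i j => φ (a + i) (a + j) := by
  rw [← natDet_transpose, natDet_block_lower a b _ (fun i hi j hj => h j hj i hi),
    natDet_transpose, natDet_transpose b fun i j => φ (a + i) (a + j)]

theorem natDet_rotate_one (N : ℕ) (φ : ℕ → ℕ → R) :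
    natDet N (fun i j => φ (if i + 1 < N then i + 1 else i + 1 - N) j) =
      (-1) ^ (N - 1) * natDet N φ := by
  rcases N with _ | N
  · simp [natDet]
  unfold natDet
  have := Matrix.det_permute (finRotate (N + 1)) (Matrix.of fun i j : Fin (N + 1) => φ i j)
  rw [sign_finRotate] at this
  push_cast at this
  rw [Nat.add_sub_cancel, ← this]
  congr 1
  ext i j
  simp only [Matrix.of_apply, Matrix.submatrix_apply, id, coe_finRotate]
  congr 1
  have := i.2
  by_cases hi : i = Fin.last N
  · subst hi
    simp
  · have : (i : ℕ) ≠ N := fun h => hi (Fin.ext h)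
    rw [if_neg hi, if_pos (by omega)]

theorem natDet_rotate_aux (N a : ℕ) (ha : a ≤ N) (φ : ℕ → ℕ → R) :
    natDet N (fun i j => φ (if i + a < N then i + a else i + a - N) j) =
      ((-1) ^ (N - 1)) ^ a * natDet N φ := by
  induction a with
  | zero =>
    rw [pow_zero, one_mul]
    refine natDet_congr fun i hi j _ => ?_
    rw [if_pos (by omega), add_zero]
  | succ a ih =>
    rw [pow_succ', mul_assoc, ← ih (by omega), ← natDet_rotate_one]
    refine natDet_congr fun i hi j _ => ?_
    congr 1
    split_ifs <;> omega

theorem natDet_rotate (a b : ℕ) (φ : ℕ → ℕ → R) :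
    natDet (a + b) (fun i j => φ (if i < b then a + i else i - b) j) =
      (-1) ^ (a * b) * natDet (a + b) φ := by
  have h := natDet_rotate_aux (a + b) a (by omega) φ
  have hs : ((-1 : R) ^ (a + b - 1)) ^ a = (-1) ^ (a * b) := by
    rcases a with _ | a
    · simp
    · have : (a + 1 + b - 1) * (a + 1) = (a + 1) * b + a * (a + 1) := by
        rw [show a + 1 + b - 1 = a + b by omega]; ring
      rw [← pow_mul, this, pow_add, (Nat.even_mul_succ_self a).neg_one_pow, mul_one]
  rw [← hs, ← h]
  refine natDet_congr fun i hi j _ => ?_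
  congr 1
  split_ifs <;> omega

theorem natDet_rotate_col (a b : ℕ) (φ : ℕ → ℕ → R) :
    natDet (a + b) (fun i j => φ i (if j < b then a + j else j - b)) =
      (-1) ^ (a * b) * natDet (a + b) φ := by
  rw [← natDet_transpose, natDet_rotate a b (fun i j => φ j i), natDet_transpose]

/-- Removing a block of `b` rows and `b` columns from a determinant. -/
theorem natDet_remove_block {N a₁ a₂ b M : ℕ} (hN : N = M + b) (h₁ : a₁ ≤ M) (h₂ : a₂ ≤ M)
    (φ : ℕ → ℕ → R)
    (h : (∀ i < M, ∀ j < b, φ (if i < a₁ then i else i + b) (a₂ + j) = 0) ∨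
      (∀ i < b, ∀ j < M, φ (a₁ + i) (if j < a₂ then j else j + b) = 0)) :
    natDet N φ = (-1) ^ (b * (a₁ + a₂)) * natDet b (fun i j => φ (a₁ + i) (a₂ + j)) *
      natDet M fun i j => φ (if i < a₁ then i else i + b) (if j < a₂ then j else j + b) := by
  obtain ⟨c₁, rfl⟩ := Nat.exists_eq_add_of_le h₁
  obtain ⟨c₂, hc₂⟩ := Nat.exists_eq_add_of_le h₂
  set ρ : ℕ → ℕ := fun i => if i < b + c₁ then a₁ + i else i - (b + c₁) with hρ
  set γ : ℕ → ℕ := fun i => if i < b + c₂ then a₂ + i else i - (b + c₂) with hγ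
  set χ : ℕ → ℕ → R := fun i j =>
    φ (if i < a₁ then i else i + b) (if j < a₂ then j else j + b) with hχ
  have e₁ : natDet N (fun i j => φ (ρ i) (γ j)) =
      (-1) ^ (a₁ * (b + c₁)) * ((-1) ^ (a₂ * (b + c₂)) * natDet N φ) := by
    have e := natDet_rotate a₁ (b + c₁) (fun i j => φ i (γ j))
    have e' := natDet_rotate_col a₂ (b + c₂) φ
    rw [show a₁ + (b + c₁) = N by omega] at e
    rw [show a₂ + (b + c₂) = N by omega] at e'
    rw [e, e']
  have e₂ : natDet N (fun i j => φ (ρ i) (γ j)) =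
      natDet b (fun i j => φ (a₁ + i) (a₂ + j)) *
        natDet (a₁ + c₁) fun i j => φ (ρ (b + i)) (γ (b + j)) := by
    have key : natDet b (fun i j => φ (ρ i) (γ j)) = natDet b fun i j => φ (a₁ + i) (a₂ + j) := by
      refine natDet_congr fun i hi j hj => ?_
      simp only [hρ, hγ]
      rw [if_pos (by omega), if_pos (by omega)]
    rw [← key, show N = b + (a₁ + c₁) by omega]
    rcases h with h | h
    · refine natDet_block_upper b (a₁ + c₁) _ fun i hi j hj => ?_
      by_cases hi' : i < c₁
      · have := h (a₁ + i) (by omega) j hj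
        convert this using 2
        · simp only [hρ]; split_ifs <;> omega
        · simp only [hγ]; split_ifs <;> omega
      · have := h (i - c₁) (by omega) j hj
        convert this using 2
        · simp only [hρ]; split_ifs <;> omega
        · simp only [hγ]; split_ifs <;> omega
    · refine natDet_block_lower b (a₁ + c₁) _ fun i hi j hj => ?_
      by_cases hj' : j < c₂
      · have := h i hi (a₂ + j) (by omega)
        convert this using 2
        · simp only [hρ]; split_ifs <;> omega
        · simp only [hγ]; split_ifs <;> omega
      · have := h i hi (j - c₂) (by omega)
        convert this using 2
        · simp only [hρ]; split_ifs <;> omega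
        · simp only [hγ]; split_ifs <;> omega
  have e₃ : natDet (a₁ + c₁) (fun i j => φ (ρ (b + i)) (γ (b + j))) =
      (-1) ^ (a₁ * c₁) * ((-1) ^ (a₂ * c₂) * natDet (a₁ + c₁) χ) := by
    have e := natDet_rotate a₁ c₁ (fun i j => χ i (if j < c₂ then a₂ + j else j - c₂))
    have e' := natDet_rotate_col a₂ c₂ χ
    rw [← hc₂] at e'
    rw [← e', ← e]
    refine natDet_congr fun i hi j hj => ?_
    simp only [hρ, hγ, hχ]
    congr 1 <;> split_ifs <;> omega
  rw [e₁, e₃] at e₂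
  have sq : ∀ l : ℕ, ((-1 : R) ^ l) * (-1) ^ l = 1 := fun l => by
    rw [← mul_pow]; simp
  have s₁ := sq (a₁ * c₁)
  have s₂ := sq (a₂ * c₂)
  have s₃ := sq (a₁ * b)
  have s₄ := sq (a₂ * b)
  rw [mul_add, mul_add, pow_add, pow_add] at e₂
  rw [show b * (a₁ + a₂) = a₁ * b + a₂ * b by ring, pow_add]
  generalize natDet (a₁ + c₁) χ = Y at *
  generalize (natDet b fun i j => φ (a₁ + i) (a₂ + j)) = Z at *
  generalize natDet N φ = D at *
  generalize (-1 : R) ^ (a₁ * b) = P at *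
  generalize (-1 : R) ^ (a₂ * b) = Q at *
  generalize (-1 : R) ^ (a₁ * c₁) = U at *
  generalize (-1 : R) ^ (a₂ * c₂) = V at *
  linear_combination P * Q * U * V * e₂ - D * Q ^ 2 * U ^ 2 * V ^ 2 * s₃ - D * U ^ 2 * V ^ 2 * s₄
    + (P * Q * Z * Y - D) * (V ^ 2 * s₁ + s₂)

end NatDet

section Vandermonde

variable {R : Type*} [CommRing R]

/-- The Vandermonde product `∏_{i<j<N} (t i - t j)`. -/
noncomputable def vandProd (N : ℕ) (t : ℕ → R) : R :=
  ∏ j ∈ range N, ∏ i ∈ range j, (t i - t j)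

theorem natDet_pow (N : ℕ) (t : ℕ → R) :
    natDet N (fun i j => t j ^ (N - 1 - i)) = vandProd N t := by
  rw [← natDet_transpose]
  have h := Matrix.det_projVandermonde (fun _ : Fin N => (1 : R)) (fun i => t i)
  simp only [one_mul] at h
  have h' : natDet N (fun i j => t i ^ (N - 1 - j)) =
      (Matrix.projVandermonde (fun _ : Fin N => (1 : R)) (fun i => t i)).det := by
    unfold natDet
    congr 1
    ext i j
    simp only [Matrix.of_apply, Matrix.projVandermonde_apply, one_pow, one_mul, Fin.val_rev]
    congr 1
    omega
  rw [h', h, vandProd, Finset.prod_range]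
  rw [Finset.prod_comm' (t' := Finset.univ) (s' := fun j => Finset.Iio j) (by simp)]
  refine Finset.prod_congr rfl fun j _ => ?_
  rw [← Nat.Iio_eq_range, ← Fin.map_valEmbedding_Iio, Finset.prod_map]
  rfl

theorem vandProd_congr {N : ℕ} {t t' : ℕ → R} (h : ∀ i < N, t i = t' i) :
    vandProd N t = vandProd N t' := by
  refine Finset.prod_congr rfl fun j hj => Finset.prod_congr rfl fun i hi => ?_
  rw [Finset.mem_range] at hi hj
  rw [h i (by omega), h j hj]

theorem vandProd_add (a b : ℕ) (t : ℕ → R) :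
    vandProd (a + b) t = vandProd a t * vandProd b (fun j => t (a + j)) *
      ∏ i ∈ range a, ∏ j ∈ range b, (t i - t (a + j)) := by
  simp only [vandProd]
  rw [Finset.prod_range_add, Finset.prod_comm (s := range a), mul_assoc, ← Finset.prod_mul_distrib]
  congr 1
  refine Finset.prod_congr rfl fun j _ => ?_
  rw [Finset.prod_range_add, mul_comm]

/-- The matrix with generic column `t^{a-1}, …, 1, 0, …, 0` for columns outside `s` and
`0, …, 0, t^{b-1}, …, 1` for columns in `s`. -/
def splitVand (a b : ℕ) {N : ℕ} (t : Fin N → R) (s : Finset (Fin N)) :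
    Matrix (Fin N) (Fin N) R :=
  Matrix.of fun i j =>
    if (i : ℕ) < a then (if j ∈ s then 0 else t j ^ (a - 1 - i))
    else (if j ∈ s then t j ^ (b - 1 - (i - a)) else 0)

theorem det_splitVand_eq_zero (a b : ℕ) {N : ℕ} (hN : N = a + b) (t : Fin N → R)
    (s : Finset (Fin N)) (hs : s.card ≠ b) : (splitVand a b t s).det = 0 := by
  rw [Matrix.det_apply]
  refine Finset.sum_eq_zero fun σ _ => ?_
  suffices h : ∏ i, splitVand a b t s (σ i) i = 0 by rw [h, smul_zero]
  by_contra hne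
  have key : ∀ i, ((σ i : Fin N) : ℕ) < a ↔ i ∉ s := by
    intro i
    have hi : splitVand a b t s (σ i) i ≠ 0 := fun h0 =>
      hne (Finset.prod_eq_zero (Finset.mem_univ i) h0)
    simp only [splitVand, Matrix.of_apply] at hi
    split_ifs at hi <;> simp_all
  apply hs
  have e : s.map σ.toEmbedding = Finset.univ.filter fun i : Fin N => ¬ (i : ℕ) < a := by
    ext i
    simp only [Finset.mem_map_equiv, Finset.mem_filter, Finset.mem_univ, true_and]
    have := key (σ.symm i)
    rw [Equiv.apply_symm_apply] at this
    tauto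
  rw [← Finset.card_map σ.toEmbedding, e, Finset.filter_not, Finset.card_sdiff_of_subset
    (Finset.filter_subset _ _), Finset.card_univ, Fintype.card_fin, Fin.card_filter_val_lt]
  omega

theorem exists_perm_mem_iff (a b : ℕ) {N : ℕ} (hN : N = a + b) (s : Finset (Fin N))
    (hs : s.card = b) : ∃ π : Equiv.Perm (Fin N), ∀ i, π i ∈ s ↔ a ≤ (i : ℕ) := by
  have hc : Fintype.card {i : Fin N // a ≤ (i : ℕ)} = Fintype.card {i : Fin N // i ∈ s} := by
    rw [Fintype.card_coe, hs, Fintype.card_subtype]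
    have := Finset.card_filter_add_card_filter_not (s := (Finset.univ : Finset (Fin N)))
      (fun i => (i : ℕ) < a)
    simp only [not_lt, Finset.card_univ, Fintype.card_fin, Fin.card_filter_val_lt] at this
    omega
  let e := Fintype.equivOfCardEq hc
  refine ⟨e.extendSubtype, fun i => ⟨fun h => ?_, fun h => e.extendSubtype_mem i h⟩⟩
  by_contra h'
  exact e.extendSubtype_not_mem i h' h

theorem det_splitVand_mul (a b : ℕ) {N : ℕ} (hN : N = a + b) (t : ℕ → R)
    (s : Finset (Fin N)) (hs : s.card = b) :
    (splitVand a b (fun i : Fin N => t i) s).det * ∏ i ∈ sᶜ, ∏ j ∈ s, (t i - t j) =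
      vandProd N t := by
  obtain ⟨π, hπ⟩ := exists_perm_mem_iff a b hN s hs
  set t' : ℕ → R := fun j => if h : j < N then t (π ⟨j, h⟩) else 0 with ht'
  have t'_eq : ∀ i : Fin N, t' i = t (π i) := fun i => by simp [ht']
  have sq : ((Equiv.Perm.sign π : ℤ) : R) * ((Equiv.Perm.sign π : ℤ) : R) = 1 := by
    rw [← Int.cast_mul]
    rcases Int.units_eq_one_or (Equiv.Perm.sign π) with h | h <;> simp [h]
  have e₁ : ((Equiv.Perm.sign π : ℤ) : R) * vandProd N t = vandProd N t' := by
    rw [← natDet_pow, ← natDet_pow]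
    unfold natDet
    rw [← Matrix.det_permute']
    congr 1
    ext i j
    simp [t'_eq]
  have e₂ : ((Equiv.Perm.sign π : ℤ) : R) * (splitVand a b (fun i : Fin N => t i) s).det =
      vandProd a t' * vandProd b fun j => t' (a + j) := by
    rw [← natDet_pow, ← natDet_pow, ← Matrix.det_permute']
    have h := natDet_block_lower a b (fun i j => if i < a then (if a ≤ j then 0 else t' j ^ (a - 1 - i))
      else (if a ≤ j then t' j ^ (b - 1 - (i - a)) else 0)) (fun i hi j hj => by simp [hi])
    rw [← hN] at h
    have h' : ((splitVand a b (fun i : Fin N => t i) s).submatrix id π).det =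
        natDet N (fun i j => if i < a then (if a ≤ j then 0 else t' j ^ (a - 1 - i))
          else (if a ≤ j then t' j ^ (b - 1 - (i - a)) else 0)) := by
      unfold natDet
      congr 1
      ext i j
      simp only [splitVand, Matrix.submatrix_apply, Matrix.of_apply, id, hπ, t'_eq]
    rw [h', h]
    congr 1
    · refine natDet_congr fun i hi j hj => ?_
      rw [if_pos hi, if_neg (by omega)]
    · refine natDet_congr fun i hi j hj => ?_
      rw [if_neg (by omega), if_pos (by omega), Nat.add_sub_cancel_left]
  have e₃ : ∏ i ∈ sᶜ, ∏ j ∈ s, (t i - t j) =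
      ∏ i ∈ range a, ∏ j ∈ range b, (t' i - t' (a + j)) := by
    have m₁ : sᶜ = (Finset.univ.filter fun i : Fin N => (i : ℕ) < a).map π.toEmbedding := by
      ext i
      have := hπ (π.symm i)
      simp only [Equiv.apply_symm_apply] at this
      simp [Finset.mem_map_equiv, this]
    have m₂ : s = (Finset.univ.filter fun i : Fin N => a ≤ (i : ℕ)).map π.toEmbedding := by
      ext i
      have := hπ (π.symm i)
      simp only [Equiv.apply_symm_apply] at this
      simp [Finset.mem_map_equiv, this]
    have r₁ : ∀ F : ℕ → R, ∏ i ∈ Finset.univ.filter (fun i : Fin N => (i : ℕ) < a), F i =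
        ∏ i ∈ range a, F i := by
      intro F
      rw [Finset.prod_filter, ← Finset.prod_range (fun i => if i < a then F i else 1), hN,
        Finset.prod_range_add]
      simp only [add_lt_iff_neg_left, not_lt_zero, if_false, Finset.prod_const_one, mul_one]
      exact Finset.prod_congr rfl fun i hi => if_pos (Finset.mem_range.1 hi)
    have r₂ : ∀ F : ℕ → R, ∏ i ∈ Finset.univ.filter (fun i : Fin N => a ≤ (i : ℕ)), F i =
        ∏ i ∈ range b, F (a + i) := by
      intro F
      rw [Finset.prod_filter, ← Finset.prod_range (fun i => if a ≤ i then F i else 1), hN,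
        Finset.prod_range_add]
      rw [Finset.prod_eq_one fun i hi => if_neg (by simpa using hi), one_mul]
      exact Finset.prod_congr rfl fun i hi => if_pos (by omega)
    rw [← r₁ fun i => ∏ j ∈ range b, (t' i - t' (a + j))]
    conv_lhs => rw [m₁]
    rw [Finset.prod_map]
    refine Finset.prod_congr rfl fun i _ => ?_
    rw [← r₂ fun j => t' i - t' j]
    conv_lhs => rw [m₂]
    rw [Finset.prod_map]
    refine Finset.prod_congr rfl fun j _ => ?_
    rw [t'_eq, t'_eq]
    rfl
  have e₄ := vandProd_add a b t'
  rw [← hN, ← e₁, ← e₂, ← e₃] at e₄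
  linear_combination (-((Equiv.Perm.sign π : ℤ) : R)) * e₄ +
    (vandProd N t - (splitVand a b (fun i : Fin N => t i) s).det *
      ∏ i ∈ sᶜ, ∏ j ∈ s, (t i - t j)) * sq

theorem det_weighted_eq_sum (a b : ℕ) {N : ℕ} (hN : N = a + b) (t w : Fin N → R) :
    (Matrix.of fun i j : Fin N => if (i : ℕ) < a then t j ^ (a - 1 - i)
      else w j * t j ^ (b - 1 - (i - a))).det =
      ∑ s ∈ Finset.powersetCard b Finset.univ, (∏ j ∈ s, w j) * (splitVand a b t s).det := by
  set v : Fin N → Fin N → R := fun j i => if (i : ℕ) < a then t j ^ (a - 1 - i) else 0 with hv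
  set u : Fin N → Fin N → R := fun j i => if (i : ℕ) < a then 0 else t j ^ (b - 1 - (i - a))
    with hu
  have e₁ : ∀ M : Fin N → Fin N → R, (Matrix.of M).det =
      (Matrix.detRowAlternating (n := Fin N) (R := R)).toMultilinearMap M := fun M => rfl
  have e₂ : (Matrix.of fun i j : Fin N => if (i : ℕ) < a then t j ^ (a - 1 - i)
      else w j * t j ^ (b - 1 - (i - a))).det =
      (Matrix.of ((fun j => w j • u j) + v)).det := by
    rw [← Matrix.det_transpose]
    congr 1
    ext j i
    simp only [Matrix.transpose_apply, Matrix.of_apply, Pi.add_apply, Pi.smul_apply, hu, hv,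
      smul_eq_mul]
    split_ifs <;> simp
  have e₃ : ∀ s : Finset (Fin N), (Matrix.of (s.piecewise (fun j => w j • u j) v)).det =
      (∏ j ∈ s, w j) * (splitVand a b t s).det := by
    intro s
    have h := (Matrix.detRowAlternating (n := Fin N) (R := R)).toMultilinearMap.map_piecewise_smul
      w (s.piecewise u v) s
    rw [← e₁, ← e₁, smul_eq_mul] at h
    have h₁ : s.piecewise (fun i => w i • s.piecewise u v i) (s.piecewise u v) =
        s.piecewise (fun j => w j • u j) v := by
      ext j i
      by_cases hj : j ∈ s <;> simp [hj]
    have h₂ : (Matrix.of (s.piecewise u v)).det = (splitVand a b t s).det := by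
      rw [← Matrix.det_transpose]
      congr 1
      ext i j
      by_cases hj : j ∈ s <;> by_cases hi : (i : ℕ) < a <;> simp [hj, hi, splitVand, hu, hv]
    rw [← h₁, h, h₂]
  rw [e₂, e₁, MultilinearMap.map_add_univ]
  simp only [← e₁, e₃]
  symm
  refine Finset.sum_subset (Finset.subset_univ _) fun s _ hs => ?_
  rw [det_splitVand_eq_zero a b hN t s (fun h => hs (by simp [h])), mul_zero]

end Vandermonde

section Subresultant

variable {R : Type*} [CommRing R]

theorem natDet_change_basis (d b : ℕ) (ρ : ℕ → R[X]) (hρ : ∀ i ≤ d, (ρ i).Monic)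
    (hd : ∀ i ≤ d, (ρ i).natDegree = d - i) (τ : ℕ → R) (χ : ℕ → ℕ → R) :
    natDet (d + 1 + b) (fun i j => if i < d + 1 then (ρ i).eval (τ j) else χ i j) =
      natDet (d + 1 + b) fun i j => if i < d + 1 then τ j ^ (d - i) else χ i j := by
  set P : ℕ → ℕ → R := fun i l => if i < d + 1 then (if l < d + 1 then (ρ i).coeff (d - l) else 0)
    else if i = l then 1 else 0 with hP
  have hdet : natDet (d + 1 + b) P = 1 := by
    refine natDet_upper (fun i _ j hj => ?_) fun i _ => ?_
    · simp only [hP]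
      split_ifs with h₁ h₂ h₃
      · exact Polynomial.coeff_eq_zero_of_natDegree_lt (by rw [hd i (by omega)]; omega)
      · rfl
      · omega
      · rfl
    · simp only [hP]
      split_ifs with h₁
      · rw [← hd i (by omega)]
        exact hρ i (by omega)
      · rfl
  rw [← one_mul (natDet _ fun i j => if i < d + 1 then τ j ^ (d - i) else χ i j), ← hdet,
    natDet_mul]
  refine natDet_congr fun i hi j _ => ?_
  by_cases h : i < d + 1
  · rw [if_pos h, Finset.sum_range_add, Finset.sum_eq_zero (s := range b), add_zero,
      Polynomial.eval_eq_sum_range' (n := d + 1) (by rw [hd i (by omega)]; omega),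
      ← Finset.sum_range_reflect]
    · refine Finset.sum_congr rfl fun l hl => ?_
      have hl := Finset.mem_range.1 hl
      simp only [hP]
      rw [if_pos h, if_pos hl, if_pos hl, show d + 1 - 1 - l = d - l by omega]
    · intro l _
      simp only [hP]
      rw [if_pos h, if_neg (by omega), zero_mul]
  · rw [if_neg h, Finset.sum_eq_single i]
    · simp only [hP]
      rw [if_neg h, if_pos trivial, if_neg h, one_mul]
    · intro l _ hl
      simp only [hP]
      rw [if_neg h, if_neg (Ne.symm hl), zero_mul]
    · intro h'
      exact absurd (Finset.mem_range.2 hi) h'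

/-- The value at `x` of the cofactor `G_k` of the `k`-th subresultant. -/
noncomputable def gMinor (m n k : ℕ) (f g : R[X]) (x : R) : R :=
  natDet ((n - k) + (m - k)) fun r c =>
    if r < n - k then
      (if c = (n - k) + (m - k) - 1 then 0
        else (X ^ (n - k - 1 - r) * f).coeff (m + n - k - 1 - c))
    else
      (if c = (n - k) + (m - k) - 1 then x ^ (m - k - 1 - (r - (n - k)))
        else (X ^ (m - k - 1 - (r - (n - k))) * g).coeff (m + n - k - 1 - c))

/-- The minor of the block `(f-multiples, g-multiples, low monomials)` against the functionals
`(coefficients, x)`. -/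
theorem natDet_eq_gMinor (m n k : ℕ) (hm : k < m) (hn : k < n) (f g : R[X]) (x : R) :
    natDet (m + n - k + 1) (fun r c =>
      if r < n - k then
        (if c < m + n - k then (X ^ (n - k - 1 - r) * f).coeff (m + n - k - 1 - c) else 0)
      else if r < (n - k) + (m - k) then
        (if c < m + n - k then
          (X ^ (m - k - 1 - (r - (n - k))) * g).coeff (m + n - k - 1 - c)
          else x ^ (m - k - 1 - (r - (n - k))))
      else if c + 1 = r then 1 else 0) =
      (-1) ^ (k + 1) * gMinor m n k f g x := by
  rw [natDet_remove_block (N := m + n - k + 1) (a₁ := (n - k) + (m - k))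
    (a₂ := (n - k) + (m - k) - 1) (b := k + 1) (M := (n - k) + (m - k)) (by omega) le_rfl (by omega)]
  · rw [natDet_upper (N := k + 1), mul_one]
    · congr 1
      · have : (k + 1) * ((n - k) + (m - k) + ((n - k) + (m - k) - 1)) =
            (k + 1) + 2 * ((k + 1) * ((n - k) + (m - k) - 1)) := by
          obtain ⟨l, hl⟩ : ∃ l, (n - k) + (m - k) = l + 1 := ⟨(n - k) + (m - k) - 1, by omega⟩
          rw [hl, Nat.add_sub_cancel]
          ring
        rw [this, pow_add, pow_mul, neg_one_sq, one_pow, mul_one]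
      · refine natDet_congr fun i hi j hj => ?_
        simp only [if_pos hi]
        by_cases h : i < n - k
        · simp only [if_pos h]
          by_cases hj' : j = (n - k) + (m - k) - 1
          · have e : (if j < (n - k) + (m - k) - 1 then j else j + (k + 1)) = m + n - k := by
              rw [if_neg (by omega)]
              omega
            rw [if_pos hj', e, if_neg (by omega)]
          · rw [if_neg hj', if_pos (c := j < (n - k) + (m - k) - 1) (by omega),
              if_pos (by omega)]
        · simp only [if_neg h]
          by_cases hj' : j = (n - k) + (m - k) - 1
          · have e : (if j < (n - k) + (m - k) - 1 then j else j + (k + 1)) = m + n - k := by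
              rw [if_neg (by omega)]
              omega
            rw [if_pos hj', e, if_neg (by omega)]
          · rw [if_neg hj', if_pos (c := j < (n - k) + (m - k) - 1) (by omega),
              if_pos (by omega)]
    · intro i hi j hj
      rw [if_neg (by omega), if_neg (by omega), if_neg (by omega)]
    · intro i hi
      rw [if_neg (by omega), if_neg (by omega), if_pos (by omega)]
  · right
    intro i hi j hj
    rw [if_neg (by omega), if_neg (by omega)]
    split_ifs <;> first | rfl | omega

theorem natDet_eval_eq_gMinor (m n k : ℕ) (hm : k < m) (hn : k < n) (a : ℕ → R) (f g : R[X])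
    (hf : f.Monic) (hfd : f.natDegree = m) (hfa : ∀ i < m, f.eval (a i) = 0)
    (hgd : g.natDegree = n) (x : R) :
    natDet (m + 1) (fun i j =>
      if i < m - k then (if j < m then a j ^ (m - k - 1 - i) * g.eval (a j) else x ^ (m - k - 1 - i))
      else (if j < m then a j ^ (m - i) else 0)) =
      (-1) ^ (k + 1) * vandProd m a * gMinor m n k f g x := by
  set P : ℕ → ℕ → R := fun c j =>
    if j < n - k then (if c = j then 1 else 0)
    else if j < m + n - k then (if c < m + n - k then a (j - (n - k)) ^ (m + n - k - 1 - c) else 0)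
    else if c = j then 1 else 0 with hP
  have hPdet : natDet (m + n - k + 1) P = vandProd m a := by
    rw [show m + n - k + 1 = (n - k) + (m + 1) by omega, natDet_block_upper, natDet_upper, one_mul,
      natDet_block_lower m 1, ← natDet_pow]
    · rw [natDet_upper (N := 1), mul_one]
      · refine natDet_congr fun i hi j hj => ?_
        simp only [hP]
        rw [if_neg (by omega), if_pos (by omega), if_pos (by omega), Nat.add_sub_cancel_left]
        congr 1
        omega
      · intro i hi j hj
        omega
      · intro i hi
        simp only [hP]
        rw [if_neg (by omega), if_neg (by omega), if_pos trivial]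
    · intro i hi j hj
      simp only [hP]
      rw [if_neg (by omega), if_neg (by omega), if_neg (by omega)]
    · intro i hi j hj
      simp only [hP]
      rw [if_pos (by omega), if_neg (by omega)]
    · intro i hi
      simp only [hP]
      rw [if_pos (by omega), if_pos trivial]
    · intro i hi j hj
      simp only [hP]
      rw [if_pos (by omega), if_neg (by omega)]
  have main := natDet_eq_gMinor m n k hm hn f g x
  set W : ℕ → ℕ → R := fun r c =>
      if r < n - k then
        (if c < m + n - k then (X ^ (n - k - 1 - r) * f).coeff (m + n - k - 1 - c) else 0)
      else if r < (n - k) + (m - k) then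
        (if c < m + n - k then
          (X ^ (m - k - 1 - (r - (n - k))) * g).coeff (m + n - k - 1 - c)
          else x ^ (m - k - 1 - (r - (n - k))))
      else if c + 1 = r then 1 else 0 with hW
  have hprod := natDet_mul (m + n - k + 1) W P
  rw [main, hPdet] at hprod
  have hpoly : ∀ p : R[X], p.natDegree < m + n - k → ∀ y : R,
      ∑ l ∈ range (m + n - k), p.coeff (m + n - k - 1 - l) * y ^ (m + n - k - 1 - l) =
        p.eval y := by
    intro p hp y
    rw [Polynomial.eval_eq_sum_range' hp, ← Finset.sum_range_reflect fun i => p.coeff i * y ^ i]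
  have col_delta : ∀ r j, (j < n - k ∨ j = m + n - k) →
      ∑ l ∈ range (m + n - k + 1), W r l * P l j = W r j := by
    intro r j hj
    rw [Finset.sum_eq_single j]
    · simp only [hP]
      split_ifs <;> first | omega | simp
    · intro l _ hl
      simp only [hP]
      split_ifs <;> first | omega | simp
    · intro h
      exact absurd (Finset.mem_range.2 (by omega)) h
  have col_a : ∀ r j, n - k ≤ j → j < m + n - k →
      ∑ l ∈ range (m + n - k + 1), W r l * P l j =
        ∑ l ∈ range (m + n - k), W r l * a (j - (n - k)) ^ (m + n - k - 1 - l) := by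
    intro r j h₁ h₂
    rw [Finset.sum_range_succ]
    have : P (m + n - k) j = 0 := by
      simp only [hP]
      rw [if_neg (by omega), if_pos h₂, if_neg (by omega)]
    rw [this, mul_zero, add_zero]
    refine Finset.sum_congr rfl fun l hl => ?_
    have hl := Finset.mem_range.1 hl
    simp only [hP]
    rw [if_neg (by omega), if_pos h₂, if_pos hl]
  have degX : ∀ (p : R[X]) (e l : ℕ), p.natDegree = l → e + l < m + n - k →
      (X ^ e * p).natDegree < m + n - k := by
    intro p e l hp h
    have := Polynomial.natDegree_mul_le (p := X ^ e) (q := p)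
    have := Polynomial.natDegree_X_pow_le (R := R) e
    omega
  have row_f : ∀ r < n - k, ∀ j, n - k ≤ j → j < m + n - k →
      ∑ l ∈ range (m + n - k + 1), W r l * P l j = 0 := by
    intro r hr j h₁ h₂
    rw [col_a r j h₁ h₂]
    have := hpoly (X ^ (n - k - 1 - r) * f) (degX f _ m hfd (by omega)) (a (j - (n - k)))
    rw [Polynomial.eval_mul, hfa _ (by omega), mul_zero] at this
    rw [← this]
    refine Finset.sum_congr rfl fun l hl => ?_
    have hl := Finset.mem_range.1 hl
    simp only [hW]
    rw [if_pos hr, if_pos hl]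
  rw [show m + n - k + 1 = (n - k) + (m + 1) by omega] at hprod
  rw [natDet_block_lower (n - k) (m + 1)] at hprod
  · rw [natDet_upper, one_mul] at hprod
    · have hfin : natDet (m + 1) (fun i j =>
          ∑ l ∈ range ((n - k) + (m + 1)), W (n - k + i) l * P l (n - k + j)) =
          natDet (m + 1) (fun i j => if i < m - k then
            (if j < m then a j ^ (m - k - 1 - i) * g.eval (a j) else x ^ (m - k - 1 - i))
            else (if j < m then a j ^ (m - i) else 0)) := by
        refine natDet_congr fun i hi j hj => ?_
        rw [show (n - k) + (m + 1) = m + n - k + 1 by omega]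
        by_cases hjm : j < m
        · rw [col_a _ _ (by omega) (by omega), Nat.add_sub_cancel_left]
          simp only [if_pos hjm]
          by_cases hik : i < m - k
          · rw [if_pos hik]
            have := hpoly (X ^ (m - k - 1 - i) * g) (degX g _ n hgd (by omega)) (a j)
            rw [Polynomial.eval_mul, Polynomial.eval_pow, Polynomial.eval_X] at this
            rw [← this]
            refine Finset.sum_congr rfl fun l hl => ?_
            have hl := Finset.mem_range.1 hl
            simp only [hW]
            rw [if_neg (by omega), if_pos (by omega), if_pos hl, Nat.add_sub_cancel_left]
          · rw [if_neg hik, Finset.sum_eq_single (n - k + i - 1)]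
            · simp only [hW]
              rw [if_neg (by omega), if_neg (by omega), if_pos (by omega), one_mul]
              congr 1
              omega
            · intro l _ hl
              simp only [hW]
              rw [if_neg (by omega), if_neg (by omega)]
              split_ifs <;> first | omega | simp
            · intro h
              exact absurd (Finset.mem_range.2 (by omega)) h
        · rw [col_delta _ _ (Or.inr (by omega))]
          simp only [if_neg hjm, hW]
          by_cases hik : i < m - k
          · rw [if_pos hik, if_neg (by omega), if_pos (by omega), if_neg (by omega),
              Nat.add_sub_cancel_left]
          · rw [if_neg hik, if_neg (by omega), if_neg (by omega)]
            split_ifs <;> first | omega | rfl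
      rw [← hfin, ← hprod]
      ring
    · intro i hi j hj
      rw [show (n - k) + (m + 1) = m + n - k + 1 by omega, col_delta _ _ (Or.inl (by omega))]
      simp only [hW]
      rw [if_pos hi, if_pos (by omega), Polynomial.coeff_X_pow_mul']
      split_ifs
      · exact Polynomial.coeff_eq_zero_of_natDegree_lt (by omega)
      · rfl
    · intro i hi
      rw [show (n - k) + (m + 1) = m + n - k + 1 by omega, col_delta _ _ (Or.inl (by omega))]
      simp only [hW]
      rw [if_pos hi, if_pos (by omega), Polynomial.coeff_X_pow_mul', if_pos (by omega),
        show m + n - k - 1 - i - (n - k - 1 - i) = m by omega, ← hfd]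
      exact hf
  · intro i hi j hj
    rw [show (n - k) + (m + 1) = m + n - k + 1 by omega]
    by_cases hjm : j < m
    · exact row_f i hi _ (by omega) (by omega)
    · rw [col_delta _ _ (Or.inr (by omega))]
      simp only [hW]
      rw [if_pos hi, if_neg (by omega)]

end Subresultant

section Endpoints

variable {R : Type*}

/-- The sequence `a 0, …, a (m-1), b 0, …, b (n-1), x, x, …`. -/
def joinPoints (m n : ℕ) (a b : ℕ → R) (x : R) (j : ℕ) : R :=
  if j < m then a j else if j < m + n then b (j - m) else x

theorem joinPoints_left {m n : ℕ} {a b : ℕ → R} {x : R} {j : ℕ} (h : j < m) :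
    joinPoints m n a b x j = a j := if_pos h

theorem joinPoints_right {m n : ℕ} {a b : ℕ → R} {x : R} {j : ℕ} (h : j < n) :
    joinPoints m n a b x (m + j) = b j := by
  rw [joinPoints, if_neg (by omega), if_pos (by omega), Nat.add_sub_cancel_left]

theorem joinPoints_last {m n : ℕ} {a b : ℕ → R} {x : R} :
    joinPoints m n a b x (m + n) = x := by
  rw [joinPoints, if_neg (by omega), if_neg (by omega)]

variable [CommRing R]

theorem monic_natDegree_mixed [Nontrivial R] {d e n : ℕ} (hd : d + 1 = e + n) (g : R[X])
    (hg : g.Monic) (hgd : g.natDegree = n) (i : ℕ) (hi : i ≤ d) :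
    (if i < e then X ^ (e - 1 - i) * g else X ^ (d - i) : R[X]).Monic ∧
      (if i < e then X ^ (e - 1 - i) * g else X ^ (d - i) : R[X]).natDegree = d - i := by
  split_ifs with h
  · refine ⟨(Polynomial.monic_X_pow _).mul hg, ?_⟩
    rw [(Polynomial.monic_X_pow _).natDegree_mul hg, Polynomial.natDegree_X_pow, hgd]
    omega
  · exact ⟨Polynomial.monic_X_pow _, Polynomial.natDegree_X_pow _⟩

theorem natDet_left_eq (m n k d : ℕ) (hd : d + k + 1 = m + n) (hm : k < m) (hn : k < n)
    (a b : ℕ → R) (f g : R[X])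
    (hf : f.Monic) (hfd : f.natDegree = m) (hfa : ∀ i < m, f.eval (a i) = 0)
    (hg : g.Monic) (hgd : g.natDegree = n) (hgb : ∀ i < n, g.eval (b i) = 0) (x : R) :
    natDet (m + n + 1) (fun i j => if i < d + 1 then joinPoints m n a b x j ^ (d - i)
      else if j < m then a j ^ (k - (i - (d + 1))) else 0) =
      (-1) ^ (n * k + k + 1) * vandProd m a * vandProd n b * (g.eval x * gMinor m n k f g x) := by
  nontriviality R
  have hρ := monic_natDegree_mixed (d := d) (e := m - k) (by omega) g hg hgd
  rw [show m + n + 1 = d + 1 + (k + 1) by omega,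
    ← natDet_change_basis d (k + 1) _ (fun i hi => (hρ i hi).1) (fun i hi => (hρ i hi).2)]
  rw [natDet_remove_block (a₁ := m - k) (a₂ := m) (b := n) (M := m + 1) (by omega) (by omega)
    (by omega)]
  · have e₁ : natDet n (fun i j => if m - k + i < d + 1 then
        (if m - k + i < m - k then X ^ (m - k - 1 - (m - k + i)) * g
          else X ^ (d - (m - k + i)) : R[X]).eval (joinPoints m n a b x (m + j))
        else if m + j < m then a (m + j) ^ (k - (m - k + i - (d + 1))) else 0) = vandProd n b := by
      rw [← natDet_pow]
      refine natDet_congr fun i hi j hj => ?_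
      rw [if_pos (by omega), if_neg (by omega), joinPoints_right hj, Polynomial.eval_pow,
        Polynomial.eval_X]
      congr 1
      omega
    have e₂ := natDet_eval_eq_gMinor m n k hm hn a f g hf hfd hfa hgd x
    have e₃ := natDet_mul_col (m + 1) (fun j => if j < m then 1 else g.eval x) (fun i j =>
      if i < m - k then (if j < m then a j ^ (m - k - 1 - i) * g.eval (a j) else x ^ (m - k - 1 - i))
      else (if j < m then a j ^ (m - i) else 0))
    rw [Finset.prod_range_succ, Finset.prod_eq_one fun i hi => if_pos (Finset.mem_range.1 hi),
      one_mul, if_neg (lt_irrefl m), e₂] at e₃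
    rw [e₁]
    have e₄ : ∀ φ ψ : ℕ → ℕ → R, (∀ i < m + 1, ∀ j < m + 1, φ i j = ψ i j) →
      natDet (m + 1) φ = natDet (m + 1) ψ := fun φ ψ h => natDet_congr h
    rw [e₄ _ _ ?_, e₃]
    · have : (-1 : R) ^ (n * (m - k + m)) = (-1) ^ (n * k) := by
        obtain ⟨l, rfl⟩ := Nat.exists_eq_add_of_lt hm
        rw [show n * (k + l + 1 - k + (k + l + 1)) = n * k + 2 * (n * (l + 1)) by
          rw [show k + l + 1 - k = l + 1 by omega]; ring, pow_add, pow_mul _ 2]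
        simp
      rw [this, add_assoc, pow_add]
      ring
    · intro i hi j hj
      by_cases hik : i < m - k
      · simp only [if_pos hik]
        rw [if_pos (by omega), Polynomial.eval_mul, Polynomial.eval_pow, Polynomial.eval_X]
        by_cases hjm : j < m
        · simp only [if_pos hjm]
          rw [joinPoints_left hjm, one_mul]
        · simp only [if_neg hjm]
          rw [show j + n = m + n by omega, joinPoints_last, mul_comm]
      · simp only [if_neg hik]
        rw [if_neg (by omega)]
        by_cases hjm : j < m
        · simp only [if_pos hjm]
          rw [one_mul]
          congr 1
          omega
        · simp only [if_neg hjm]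
          rw [if_neg (by omega), mul_zero]
  · left
    intro i hi j hj
    by_cases hik : i < m - k
    · simp only [if_pos hik]
      rw [if_pos (by omega), joinPoints_right hj, Polynomial.eval_mul, hgb j hj, mul_zero]
    · simp only [if_neg hik]
      rw [if_neg (by omega), if_neg (by omega)]

/-- The value at `x` of the cofactor `F_k` of the `k`-th subresultant. -/
noncomputable def fMinor (m n k : ℕ) (f g : R[X]) (x : R) : R :=
  natDet ((n - k) + (m - k)) fun r c =>
    if r < n - k then
      (if c = (n - k) + (m - k) - 1 then x ^ (n - k - 1 - r)
        else (X ^ (n - k - 1 - r) * f).coeff (m + n - k - 1 - c))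
    else
      (if c = (n - k) + (m - k) - 1 then 0
        else (X ^ (m - k - 1 - (r - (n - k))) * g).coeff (m + n - k - 1 - c))

theorem gMinor_swap (m n k : ℕ) (f g : R[X]) (x : R) :
    gMinor n m k g f x = (-1) ^ ((n - k) * (m - k)) * fMinor m n k f g x := by
  rw [fMinor, ← natDet_rotate, gMinor, add_comm (m - k) (n - k)]
  refine natDet_congr fun r hr c hc => ?_
  rw [add_comm n m]
  by_cases h : r < m - k
  · simp only [if_pos h]
    rw [if_neg (c := n - k + r < n - k) (by omega), Nat.add_sub_cancel_left]
  · simp only [if_neg h]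
    rw [if_pos (c := r - (m - k) < n - k) (by omega)]

theorem natDet_right_eq (m n k d : ℕ) (hd : d + k + 1 = m + n) (hm : k < m) (hn : k < n)
    (a b : ℕ → R) (f g : R[X])
    (hf : f.Monic) (hfd : f.natDegree = m) (hfa : ∀ i < m, f.eval (a i) = 0)
    (hg : g.Monic) (hgd : g.natDegree = n) (hgb : ∀ i < n, g.eval (b i) = 0) (x : R) :
    natDet (m + n + 1) (fun i j => if i < d + 1 then joinPoints m n a b x j ^ (d - i)
      else if j < m then 0 else if j < m + n then -b (j - m) ^ (k - (i - (d + 1))) else 0) =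
      (-1) ^ (n * k + k) * vandProd m a * vandProd n b * (f.eval x * fMinor m n k f g x) := by
  nontriviality R
  have hρ := monic_natDegree_mixed (d := d) (e := n - k) (by omega) f hf hfd
  rw [show m + n + 1 = d + 1 + (k + 1) by omega,
    ← natDet_change_basis d (k + 1) _ (fun i hi => (hρ i hi).1) (fun i hi => (hρ i hi).2)]
  rw [natDet_remove_block (a₁ := n - k) (a₂ := 0) (b := m) (M := n + 1) (by omega) (by omega)
    (by omega)]
  · have e₁ : natDet m (fun i j => if n - k + i < d + 1 then
        (if n - k + i < n - k then X ^ (n - k - 1 - (n - k + i)) * f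
          else X ^ (d - (n - k + i)) : R[X]).eval (joinPoints m n a b x (0 + j))
        else if 0 + j < m then 0 else
          if 0 + j < m + n then -b (0 + j - m) ^ (k - (n - k + i - (d + 1))) else 0) =
        vandProd m a := by
      rw [← natDet_pow]
      refine natDet_congr fun i hi j hj => ?_
      rw [if_pos (by omega), if_neg (by omega), zero_add, joinPoints_left hj, Polynomial.eval_pow,
        Polynomial.eval_X]
      congr 1
      omega
    have e₂ := natDet_eval_eq_gMinor n m k hn hm b g f hg hgd hgb hfd x
    rw [gMinor_swap] at e₂
    have e₃ := natDet_mul_col (n + 1) (fun j => if j < n then 1 else f.eval x) (fun i j =>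
      if i < n - k then (if j < n then b j ^ (n - k - 1 - i) * f.eval (b j) else x ^ (n - k - 1 - i))
      else (if j < n then b j ^ (n - i) else 0))
    rw [Finset.prod_range_succ, Finset.prod_eq_one fun i hi => if_pos (Finset.mem_range.1 hi),
      one_mul, if_neg (lt_irrefl n), e₂] at e₃
    have e₅ := natDet_mul_row (n + 1) (fun i => if i < n - k then 1 else -1) (fun i j =>
      (if j < n then 1 else f.eval x) *
      (if i < n - k then (if j < n then b j ^ (n - k - 1 - i) * f.eval (b j) else x ^ (n - k - 1 - i))
      else (if j < n then b j ^ (n - i) else 0)))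
    have e₆ : ∏ i ∈ range (n + 1), (if i < n - k then 1 else -1 : R) = (-1) ^ (k + 1) := by
      rw [show n + 1 = (n - k) + (k + 1) by omega, Finset.prod_range_add,
        Finset.prod_eq_one fun i hi => if_pos (Finset.mem_range.1 hi)]
      simp
    rw [e₆, e₃] at e₅
    rw [e₁]
    have e₄ : ∀ φ ψ : ℕ → ℕ → R, (∀ i < n + 1, ∀ j < n + 1, φ i j = ψ i j) →
      natDet (n + 1) φ = natDet (n + 1) ψ := fun φ ψ h => natDet_congr h
    rw [e₄ _ _ ?_, e₅]
    · have : (-1 : R) ^ (m * (n - k + 0)) * (-1) ^ ((n - k) * (m - k)) = (-1) ^ (n * k + k) := by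
        obtain ⟨l, rfl⟩ := Nat.exists_eq_add_of_lt hm
        obtain ⟨l', rfl⟩ := Nat.exists_eq_add_of_lt hn
        rw [show k + l + 1 - k = l + 1 by omega, show k + l' + 1 - k = l' + 1 by omega, ← pow_add]
        have e : (k + l + 1) * (l' + 1 + 0) + (l' + 1) * (l + 1) + k * (k + 1) =
            (k + l' + 1) * k + k + 2 * ((l + 1) * (l' + 1)) := by ring
        have e' := congrArg (fun j => (-1 : R) ^ j) e
        simp only [pow_add _ _ (k * (k + 1)), (Nat.even_mul_succ_self k).neg_one_pow, mul_one] at e'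
        rw [e', pow_add _ _ (2 * _), pow_mul _ 2]
        simp
      have sq : (-1 : R) ^ (k + 1) * (-1) ^ (k + 1) = 1 := by rw [← mul_pow]; simp
      rw [← this]
      linear_combination (-1 : R) ^ (m * (n - k + 0)) * (-1) ^ ((n - k) * (m - k)) *
        vandProd m a * vandProd n b * (f.eval x * fMinor m n k f g x) * sq
    · intro i hi j hj
      by_cases hik : i < n - k
      · simp only [if_pos hik]
        rw [if_pos (by omega), Polynomial.eval_mul, Polynomial.eval_pow, Polynomial.eval_X,
          if_neg (Nat.not_lt_zero j), add_comm j m]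
        by_cases hjm : j < n
        · simp only [if_pos hjm]
          rw [joinPoints_right hjm, one_mul, one_mul]
        · simp only [if_neg hjm]
          rw [show m + j = m + n by omega, joinPoints_last, mul_comm, one_mul]
      · simp only [if_neg hik]
        rw [if_neg (by omega), if_neg (Nat.not_lt_zero j), if_neg (by omega)]
        by_cases hjm : j < n
        · simp only [if_pos hjm]
          rw [if_pos (by omega), one_mul, neg_one_mul, Nat.add_sub_cancel]
          congr 2
          omega
        · simp only [if_neg hjm]
          rw [if_neg (by omega), mul_zero, mul_zero]
  · left
    intro i hi j hj
    by_cases hik : i < n - k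
    · simp only [if_pos hik]
      rw [if_pos (by omega), zero_add, joinPoints_left hj, Polynomial.eval_mul, hfa j hj, mul_zero]
    · simp only [if_neg hik]
      rw [if_neg (by omega), if_pos (by omega)]

end Endpoints

section Pencil

variable {R : Type*} [CommRing R]

theorem natDet_add_rows {N a b : ℕ} (hN : N ≤ a + b) (hb : 0 < b) (hba : b ≤ a)
    (φ ψ : ℕ → ℕ → R) :
    natDet N (fun i j => if i < a then φ i j else ψ i j + φ (i - b) j) =
      natDet N fun i j => if i < a then φ i j else ψ i j := by
  set P : ℕ → ℕ → R := fun i l => if l = i then 1 else if i < a then 0 else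
    if l = i - b then 1 else 0 with hP
  have hdet : natDet N P = 1 := by
    refine natDet_lower (fun j _ i hij => ?_) fun i _ => if_pos rfl
    simp only [hP]
    rw [if_neg (by omega)]
    split_ifs
    · rfl
    · omega
    · rfl
  rw [← one_mul (natDet N fun i j => if i < a then φ i j else ψ i j), ← hdet, natDet_mul]
  refine natDet_congr fun i hi j _ => ?_
  have hmem := Finset.mem_range.2 hi
  rw [← Finset.add_sum_erase _ _ hmem]
  simp only [hP]
  rw [if_pos trivial, one_mul]
  by_cases h : i < a
  · rw [if_pos h, if_pos h, Finset.sum_eq_zero, add_zero]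
    intro l hl
    rw [if_neg (Finset.ne_of_mem_erase hl), if_pos h, zero_mul]
  · rw [if_neg h, if_neg h, Finset.sum_eq_single (i - b)]
    · rw [if_neg (by omega), if_neg h, if_pos rfl, if_pos (by omega), one_mul]
    · intro l hl hne
      rw [if_neg (Finset.ne_of_mem_erase hl), if_neg h, if_neg hne, zero_mul]
    · intro hmem'
      exact absurd (Finset.mem_erase.2 ⟨by omega, Finset.mem_range.2 (by omega)⟩) hmem'

theorem natDet_last_col (N : ℕ) (φ : ℕ → ℕ → R) (u v : ℕ → R) (y z : R) :
    natDet (N + 1) (fun i j => if j < N then φ i j else y * u i + z * v i) =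
      y * natDet (N + 1) (fun i j => if j < N then φ i j else u i) +
        z * natDet (N + 1) fun i j => if j < N then φ i j else v i := by
  have h : ∀ w : ℕ → R, natDet (N + 1) (fun i j => if j < N then φ i j else w i) =
      ((Matrix.of fun i j : Fin (N + 1) => φ i j).updateCol (Fin.last N) fun i => w i).det := by
    intro w
    unfold natDet
    congr 1
    ext i j
    rw [Matrix.updateCol_apply]
    rcases Fin.eq_castSucc_or_eq_last j with ⟨j, rfl⟩ | rfl
    · simp [(Fin.castSucc_lt_last j).ne]
    · simp
  rw [h, h, h, ← Matrix.det_updateCol_smul, ← Matrix.det_updateCol_smul,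
    ← Matrix.det_updateCol_add]
  rfl

theorem natDet_pencil (m n k d : ℕ) (hd : d + k + 1 = m + n) (hkd : k ≤ d) (a b : ℕ → R) (x y : R)
    (hy : IsLeftRegular y) :
    natDet (m + n + 1) (fun i j => if i < d + 1 then joinPoints m n a b x j ^ (d - i) else
        (if j < m then y + 1 else if j < m + n then 1 else 0) *
          joinPoints m n a b x j ^ (k - (i - (d + 1)))) =
      y ^ k * ((y + 1) * natDet (m + n + 1) (fun i j =>
          if i < d + 1 then joinPoints m n a b x j ^ (d - i)
          else if j < m then a j ^ (k - (i - (d + 1))) else 0) -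
        natDet (m + n + 1) (fun i j => if i < d + 1 then joinPoints m n a b x j ^ (d - i)
          else if j < m then 0 else
            if j < m + n then -b (j - m) ^ (k - (i - (d + 1))) else 0)) := by
  set t := joinPoints m n a b x with ht
  have hrow : ∀ ψ : ℕ → ℕ → R,
      natDet (m + n + 1) (fun i j => if i < d + 1 then t j ^ (d - i) else
        ψ i j + t j ^ (k - (i - (d + 1)))) =
      natDet (m + n + 1) (fun i j => if i < d + 1 then t j ^ (d - i) else ψ i j) := by
    intro ψ
    rw [← natDet_add_rows (a := d + 1) (b := k + 1) (by omega) (by omega) (by omega)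
      (fun i j => t j ^ (d - i)) ψ]
    refine natDet_congr fun i hi j _ => ?_
    by_cases h : i < d + 1
    · rw [if_pos h, if_pos h]
    · rw [if_neg h, if_neg h, show d - (i - (k + 1)) = k - (i - (d + 1)) by omega]
  have t_a : ∀ j < m, t j = a j := fun j hj => joinPoints_left hj
  have t_b : ∀ j < m + n, ¬ j < m → t j = b (j - m) := fun j hj hj' => by
    rw [ht, joinPoints, if_neg hj', if_pos hj]
  have t_x : ∀ j, ¬ j < m + n → t j = x := fun j hj => by
    rw [ht, joinPoints, if_neg (by omega), if_neg hj]
  have e₁ := hrow fun i j => ((if j < m then y + 1 else if j < m + n then 1 else 0) - 1) *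
    t j ^ (k - (i - (d + 1)))
  have e₂ := hrow fun i j => if j < m then 0 else
    if j < m + n then -b (j - m) ^ (k - (i - (d + 1))) else 0
  have e₃ := natDet_mul_col (m + n + 1) (fun j => if j < m + n then 1 else y) fun i j =>
    if i < d + 1 then t j ^ (d - i) else
      ((if j < m then y + 1 else if j < m + n then 1 else 0) - 1) * t j ^ (k - (i - (d + 1)))
  have e₄ := natDet_mul_row (m + n + 1) (fun i => if i < d + 1 then 1 else y) fun i j =>
    if j < m + n then (if i < d + 1 then t j ^ (d - i) else if j < m then a j ^ (k - (i - (d + 1)))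
      else 0)
    else (y + 1) * (if i < d + 1 then x ^ (d - i) else 0) +
      (-1) * (if i < d + 1 then x ^ (d - i) else x ^ (k - (i - (d + 1))))
  rw [natDet_last_col] at e₄
  have p₁ : ∏ j ∈ range (m + n + 1), (if j < m + n then 1 else y) = y := by
    rw [Finset.prod_range_succ, Finset.prod_eq_one fun i hi => if_pos (Finset.mem_range.1 hi),
      one_mul, if_neg (lt_irrefl _)]
  have p₂ : ∏ i ∈ range (m + n + 1), (if i < d + 1 then 1 else y) = y ^ (k + 1) := by
    rw [show m + n + 1 = d + 1 + (k + 1) by omega, Finset.prod_range_add,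
      Finset.prod_eq_one fun i hi => if_pos (Finset.mem_range.1 hi), one_mul,
      Finset.prod_congr rfl fun i _ => if_neg (by omega), Finset.prod_const, Finset.card_range]
  rw [p₁] at e₃
  rw [p₂] at e₄
  have c₁ : natDet (m + n + 1) (fun i j => if i < d + 1 then t j ^ (d - i) else
        (if j < m then y + 1 else if j < m + n then 1 else 0) * t j ^ (k - (i - (d + 1)))) =
      natDet (m + n + 1) (fun i j => if i < d + 1 then t j ^ (d - i) else
        ((if j < m then y + 1 else if j < m + n then 1 else 0) - 1) * t j ^ (k - (i - (d + 1)))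
        + t j ^ (k - (i - (d + 1)))) := by
    refine natDet_congr fun i _ j _ => ?_
    congr 1
    ring
  have c₂ : natDet (m + n + 1) (fun i j => (if j < m + n then 1 else y) *
      (if i < d + 1 then t j ^ (d - i) else
      ((if j < m then y + 1 else if j < m + n then 1 else 0) - 1) * t j ^ (k - (i - (d + 1))))) =
    natDet (m + n + 1) (fun i j => (if i < d + 1 then 1 else y) *
      (if j < m + n then (if i < d + 1 then t j ^ (d - i) else
        if j < m then a j ^ (k - (i - (d + 1))) else 0)
      else (y + 1) * (if i < d + 1 then x ^ (d - i) else 0) +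
        (-1) * (if i < d + 1 then x ^ (d - i) else x ^ (k - (i - (d + 1)))))) := by
    refine natDet_congr fun i _ j _ => ?_
    by_cases hi : i < d + 1 <;> by_cases hj : j < m + n
    · simp only [if_pos hi, if_pos hj]
    · simp only [if_pos hi, if_neg hj, t_x j hj]
      ring
    · by_cases hjm : j < m
      · simp only [if_neg hi, if_pos hj, if_pos hjm, t_a j hjm]
        ring
      · simp only [if_neg hi, if_pos hj, if_neg hjm]
        ring
    · simp only [if_neg hi, if_neg hj, if_neg (show ¬ j < m by omega), t_x j hj]
      ring
  have c₃ : natDet (m + n + 1) (fun i j => if j < m + n then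
      (if i < d + 1 then t j ^ (d - i) else if j < m then a j ^ (k - (i - (d + 1))) else 0)
      else if i < d + 1 then x ^ (d - i) else 0) =
    natDet (m + n + 1) (fun i j => if i < d + 1 then t j ^ (d - i)
          else if j < m then a j ^ (k - (i - (d + 1))) else 0) := by
    refine natDet_congr fun i _ j _ => ?_
    by_cases hj : j < m + n
    · rw [if_pos hj]
    · rw [if_neg hj, t_x j hj, if_neg (show ¬ j < m by omega)]
  have c₄ : natDet (m + n + 1) (fun i j => if j < m + n then
      (if i < d + 1 then t j ^ (d - i) else if j < m then a j ^ (k - (i - (d + 1))) else 0)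
      else if i < d + 1 then x ^ (d - i) else x ^ (k - (i - (d + 1)))) =
    natDet (m + n + 1) (fun i j => if i < d + 1 then t j ^ (d - i) else
      (if j < m then 0 else if j < m + n then -b (j - m) ^ (k - (i - (d + 1))) else 0) +
        t j ^ (k - (i - (d + 1)))) := by
    refine natDet_congr fun i _ j _ => ?_
    by_cases hj : j < m + n
    · by_cases hjm : j < m
      · simp only [if_pos hj, if_pos hjm, t_a j hjm, zero_add]
      · simp only [if_pos hj, if_neg hjm, t_b j hj hjm, neg_add_cancel]
    · simp only [if_neg hj, if_neg (show ¬ j < m by omega), t_x j hj, zero_add]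
  apply hy
  dsimp only
  rw [c₁, e₁, ← e₃, c₂, e₄, c₃, c₄, e₂]
  ring

end Pencil

section JoinSet

variable {R : Type*} [CommRing R] {m n : ℕ}

/-- The subset of `Fin (m + n + 1)` made of `P` in the first `m` places and `Q` in the next `n`
places. -/
def joinSet (P : Finset (Fin m)) (Q : Finset (Fin n)) : Finset (Fin (m + n + 1)) :=
  ((P.disjSum Q).map finSumFinEquiv.toEmbedding).map Fin.castSuccEmb

theorem castAdd_mem_joinSet {P : Finset (Fin m)} {Q : Finset (Fin n)} {i : Fin m} :
    (Fin.castAdd n i).castSucc ∈ joinSet P Q ↔ i ∈ P := by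
  rw [joinSet, ← Fin.coe_castSuccEmb, Finset.mem_map', ← finSumFinEquiv_apply_left,
    ← Equiv.coe_toEmbedding, Finset.mem_map', Finset.inl_mem_disjSum]

theorem natAdd_mem_joinSet {P : Finset (Fin m)} {Q : Finset (Fin n)} {j : Fin n} :
    (Fin.natAdd m j).castSucc ∈ joinSet P Q ↔ j ∈ Q := by
  rw [joinSet, ← Fin.coe_castSuccEmb, Finset.mem_map', ← finSumFinEquiv_apply_right,
    ← Equiv.coe_toEmbedding, Finset.mem_map', Finset.inr_mem_disjSum]

theorem last_notMem_joinSet {P : Finset (Fin m)} {Q : Finset (Fin n)} :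
    Fin.last (m + n) ∉ joinSet P Q := by
  simp [joinSet, Fin.castSucc_ne_last]

theorem card_joinSet (P : Finset (Fin m)) (Q : Finset (Fin n)) :
    (joinSet P Q).card = P.card + Q.card := by
  simp [joinSet]

theorem prod_joinSet (P : Finset (Fin m)) (Q : Finset (Fin n)) (F : ℕ → R) :
    ∏ i ∈ joinSet P Q, F i = (∏ i ∈ P, F i) * ∏ j ∈ Q, F (m + j) := by
  simp [joinSet, Finset.prod_disjSum]

theorem compl_joinSet (P : Finset (Fin m)) (Q : Finset (Fin n)) :
    (joinSet P Q)ᶜ = insert (Fin.last (m + n)) (joinSet Pᶜ Qᶜ) := by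
  ext i
  rw [Finset.mem_compl, Finset.mem_insert]
  rcases Fin.eq_castSucc_or_eq_last i with ⟨i, rfl⟩ | rfl
  · induction i using Fin.addCases with
    | left i => simp [castAdd_mem_joinSet, Fin.castSucc_ne_last]
    | right j => rw [natAdd_mem_joinSet, natAdd_mem_joinSet, Finset.mem_compl,
        or_iff_right (Fin.castSucc_ne_last _)]
  · simp [last_notMem_joinSet]

theorem prod_compl_joinSet (P : Finset (Fin m)) (Q : Finset (Fin n)) (F : ℕ → R) :
    ∏ i ∈ (joinSet P Q)ᶜ, F i = (∏ i ∈ Pᶜ, F i) * (∏ j ∈ Qᶜ, F (m + j)) * F (m + n) := by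
  rw [compl_joinSet, Finset.prod_insert last_notMem_joinSet, prod_joinSet, mul_comm, Fin.val_last]

theorem sum_powersetCard_joinSet (c : ℕ) (F : Finset (Fin (m + n + 1)) → R)
    (hF : ∀ s, Fin.last (m + n) ∈ s → F s = 0) :
    ∑ s ∈ powersetCard c univ, F s = ∑ u : Finset (Fin m) × Finset (Fin n) with
      u.1.card + u.2.card = c, F (joinSet u.1 u.2) := by
  symm
  refine Finset.sum_of_injOn (fun u => joinSet u.1 u.2) ?_ ?_ ?_ fun _ _ => rfl
  · rintro ⟨P, Q⟩ - ⟨P', Q'⟩ - h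
    simp only at h
    congr 1
    · ext i
      rw [← castAdd_mem_joinSet (Q := Q), h, castAdd_mem_joinSet]
    · ext i
      rw [← natAdd_mem_joinSet (P := P), h, natAdd_mem_joinSet]
  · rintro ⟨P, Q⟩ h
    simpa [card_joinSet] using h
  · intro s hs hs'
    refine hF s ?_
    by_contra hl
    have e : joinSet (univ.filter fun i => (Fin.castAdd n i).castSucc ∈ s)
        (univ.filter fun j => (Fin.natAdd m j).castSucc ∈ s) = s := by
      ext i
      rcases Fin.eq_castSucc_or_eq_last i with ⟨i, rfl⟩ | rfl
      · induction i using Fin.addCases with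
        | left i => simp [castAdd_mem_joinSet]
        | right j => rw [natAdd_mem_joinSet, Finset.mem_filter_univ]
      · simp [last_notMem_joinSet, hl]
    have hc := congrArg Finset.card e
    rw [card_joinSet, Finset.mem_powersetCard_univ.1 hs] at hc
    exact hs' ⟨(_, _), Finset.mem_filter_univ _ |>.2 hc, e⟩

theorem map_det_splitVand {S : Type*} [CommRing S] (θ : R →+* S) (a b : ℕ) {N : ℕ} (t : Fin N → R)
    (s : Finset (Fin N)) :
    θ (splitVand a b t s).det = (splitVand a b (fun i => θ (t i)) s).det := by
  rw [RingHom.map_det]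
  congr 1
  ext i j
  simp only [splitVand, RingHom.mapMatrix_apply, Matrix.map_apply, Matrix.of_apply]
  split_ifs <;> simp

theorem prod_prod_neg_sub {ι κ : Type*} (s : Finset ι) (t : Finset κ) (u : ι → R) (v : κ → R) :
    ∏ i ∈ s, ∏ j ∈ t, (u i - v j) = (-1) ^ (s.card * t.card) * ∏ j ∈ t, ∏ i ∈ s, (v j - u i) := by
  rw [Finset.prod_comm, mul_comm s.card, pow_mul', ← Finset.prod_const, ← Finset.prod_mul_distrib]
  refine Finset.prod_congr rfl fun j _ => ?_
  rw [← Finset.prod_const, ← Finset.prod_mul_distrib]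
  exact Finset.prod_congr rfl fun i _ => by ring

theorem prod_univ_split {N : ℕ} (s : Finset (Fin N)) (F : ℕ → R) :
    ∏ i ∈ range N, F i = (∏ i ∈ s, F i) * ∏ i ∈ sᶜ, F i := by
  rw [Finset.prod_mul_prod_compl, Finset.prod_range]

/-- The factorization of `det_splitVand_joinSet` up to the factors that cancel. -/
theorem det_splitVand_joinSet_mul {d k : ℕ} (hd : d + k + 1 = m + n) (t : ℕ → R)
    (P : Finset (Fin m)) (Q : Finset (Fin n)) (h : P.card + Q.card = k + 1) :
    ((splitVand (d + 1) (k + 1) (fun i : Fin (m + n + 1) => t i) (joinSet P Q)).det *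
      ((∏ i ∈ Pᶜ, ∏ i' ∈ P, (t i - t i')) * ∏ j ∈ Qᶜ, ∏ j' ∈ Q, (t (m + j) - t (m + j')))) *
      ((∏ i ∈ Pᶜ, ∏ j ∈ Q, (t i - t (m + j))) * (∏ j ∈ Qᶜ, ∏ i ∈ P, (t (m + j) - t i)) *
        ((∏ i ∈ P, (t (m + n) - t i)) * ∏ j ∈ Q, (t (m + n) - t (m + j)))) =
    ((-1) ^ (Qᶜ.card * P.card + m + n) * vandProd m t * vandProd n (fun j => t (m + j)) *
      ((∏ i ∈ Pᶜ, (t (m + n) - t i)) * (∏ j ∈ Qᶜ, (t (m + n) - t (m + j))) *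
        ((∏ i ∈ Pᶜ, ∏ j ∈ Qᶜ, (t i - t (m + j))) * ∏ i ∈ P, ∏ j ∈ Q, (t i - t (m + j))))) *
      ((∏ i ∈ Pᶜ, ∏ j ∈ Q, (t i - t (m + j))) * (∏ j ∈ Qᶜ, ∏ i ∈ P, (t (m + j) - t i)) *
        ((∏ i ∈ P, (t (m + n) - t i)) * ∏ j ∈ Q, (t (m + n) - t (m + j)))) := by
  have e₁ := det_splitVand_mul (d + 1) (k + 1) (N := m + n + 1) (by omega) t (joinSet P Q)
    (by rw [card_joinSet, h])
  simp only [fun i : Fin (m + n + 1) => prod_joinSet P Q fun j => t i - t j] at e₁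
  rw [prod_compl_joinSet P Q fun i => (∏ i' ∈ P, (t i - t i')) * ∏ j ∈ Q, (t i - t (m + j)),
    vandProd_add, vandProd_add, Finset.prod_range_add] at e₁
  have hsub : ∀ (N : ℕ) (F : ℕ → R), ∏ i ∈ range N, (F i - t (m + n)) =
      (-1) ^ N * ∏ i ∈ range N, (t (m + n) - F i) := by
    intro N F
    rw [Finset.prod_congr rfl fun i _ => (neg_one_mul (t (m + n) - F i)).trans (neg_sub _ _) |>.symm,
      Finset.prod_mul_distrib, Finset.prod_const, Finset.card_range]
  simp only [Finset.prod_range_one, add_zero] at e₁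
  have hone : vandProd 1 (fun j => t (m + n + j)) = 1 := by simp [vandProd]
  rw [hone, hsub m t, hsub n fun j => t (m + j), prod_univ_split P fun i => t (m + n) - t i,
    prod_univ_split Q fun j => t (m + n) - t (m + j),
    prod_univ_split P fun i => ∏ j ∈ range n, (t i - t (m + j))] at e₁
  simp only [fun i => prod_univ_split Q fun j => t i - t (m + j), Finset.prod_mul_distrib] at e₁
  rw [prod_prod_neg_sub P Qᶜ (fun i => t i) fun j => t (m + j)] at e₁
  linear_combination e₁

/-- The determinant of `splitVand` at a subset of the points `t 0, …, t (m + n)` avoiding the last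
one. -/
theorem det_splitVand_joinSet {d k : ℕ} (hd : d + k + 1 = m + n) (t : ℕ → R)
    (P : Finset (Fin m)) (Q : Finset (Fin n)) (h : P.card + Q.card = k + 1) :
    (splitVand (d + 1) (k + 1) (fun i : Fin (m + n + 1) => t i) (joinSet P Q)).det *
      ((∏ i ∈ Pᶜ, ∏ i' ∈ P, (t i - t i')) * ∏ j ∈ Qᶜ, ∏ j' ∈ Q, (t (m + j) - t (m + j'))) =
    (-1) ^ (Qᶜ.card * P.card + m + n) * vandProd m t * vandProd n (fun j => t (m + j)) *
      ((∏ i ∈ Pᶜ, (t (m + n) - t i)) * (∏ j ∈ Qᶜ, (t (m + n) - t (m + j))) *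
        ((∏ i ∈ Pᶜ, ∏ j ∈ Qᶜ, (t i - t (m + j))) * ∏ i ∈ P, ∏ j ∈ Q, (t i - t (m + j)))) := by
  have hX : ∀ i j : ℕ, i ≠ j → (MvPolynomial.X i - MvPolynomial.X j : MvPolynomial ℕ ℤ) ≠ 0 :=
    fun i j hij h0 => hij (MvPolynomial.X_injective (sub_eq_zero.1 h0))
  have key := mul_right_cancel₀ ?_
    (det_splitVand_joinSet_mul hd (fun i => (MvPolynomial.X i : MvPolynomial ℕ ℤ)) P Q h)
  · have := congrArg (MvPolynomial.eval₂Hom (Int.castRingHom R) t) key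
    simpa only [map_mul, map_pow, map_neg, map_one, map_prod, map_sub, vandProd,
      map_det_splitVand, MvPolynomial.eval₂Hom_X'] using this
  · simp only [ne_eq, mul_eq_zero, Finset.prod_eq_zero_iff, not_or, not_exists, not_and]
    refine ⟨⟨fun i _ j _ => hX _ _ ?_, fun j _ i _ => hX _ _ ?_⟩, fun i _ => hX _ _ ?_,
      fun j _ => hX _ _ ?_⟩ <;> omega

theorem coeff_pencil (k p' q' : ℕ) (h : p' + q' = k + 1) (u v : R) :
    ((X - 1 : R[X]) ^ k * (X * C u - C v)).coeff p' =
      (-1) ^ q' * (k.choose q' * u + k.choose p' * v) := by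
  have hc : ∀ i, ((X - 1 : R[X]) ^ k).coeff i = (-1) ^ (k - i) * k.choose i := by
    intro i
    have := Polynomial.coeff_X_add_C_pow (-1 : R) k i
    rwa [C_neg, C_1, ← sub_eq_add_neg] at this
  rw [mul_sub, Polynomial.coeff_sub, ← mul_assoc, Polynomial.coeff_mul_C, Polynomial.coeff_mul_C,
    hc]
  have hv : (-1 : R) ^ (k - p') * k.choose p' = -((-1) ^ q' * k.choose p') := by
    rcases q' with _ | q'
    · rw [Nat.choose_eq_zero_of_lt (by omega)]
      simp
    · rw [show k - p' = q' by omega]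
      ring
  have hu : ((X - 1 : R[X]) ^ k * X).coeff p' = (-1 : R) ^ q' * k.choose q' := by
    rcases p' with _ | p'
    · rw [Nat.choose_eq_zero_of_lt (by omega)]
      simp
    · rw [Polynomial.coeff_mul_X, hc, show k - p' = q' by omega,
        Nat.choose_symm_of_eq_add (show k = p' + q' by omega)]
  rw [hu, hv]
  ring

theorem sum_det_splitVand_joinSet {d k p' q' : ℕ} (hd : d + k + 1 = m + n) (hkd : k ≤ d)
    (h : p' + q' = k + 1) (a b : ℕ → R) (x : R) :
    ∑ P ∈ powersetCard p' univ, ∑ Q ∈ powersetCard q' univ, (splitVand (d + 1) (k + 1)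
      (fun i : Fin (m + n + 1) => joinPoints m n a b x i) (joinSet P Q)).det =
    (-1) ^ q' * (k.choose q' * natDet (m + n + 1) (fun i j =>
          if i < d + 1 then joinPoints m n a b x j ^ (d - i)
          else if j < m then a j ^ (k - (i - (d + 1))) else 0) +
      k.choose p' * natDet (m + n + 1) (fun i j =>
          if i < d + 1 then joinPoints m n a b x j ^ (d - i)
          else if j < m then 0 else
            if j < m + n then -b (j - m) ^ (k - (i - (d + 1))) else 0)) := by
  have hj : ∀ j, joinPoints m n (fun i => C (a i)) (fun i => C (b i)) (C x) j =
      C (joinPoints m n a b x j) := by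
    intro j
    unfold joinPoints
    split_ifs <;> rfl
  have e := natDet_pencil m n k d hd hkd (fun i => C (a i)) (fun i => C (b i)) (C x) (X - 1 : R[X])
    (by simpa using (Polynomial.monic_X_sub_C (1 : R)).isRegular.left)
  have eC : ∀ φ : ℕ → ℕ → R, natDet (m + n + 1) (fun i j => C (φ i j)) =
      C (natDet (m + n + 1) φ) := fun φ => (map_natDet C _ _).symm
  rw [sub_add_cancel] at e
  rw [← coeff_pencil k p' q' h, ← eC, ← eC]
  simp only [apply_ite C, C_pow, C_neg, C_0, ← hj]
  rw [← e]
  unfold natDet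
  have e₂ := det_weighted_eq_sum (d + 1) (k + 1) (N := m + n + 1) (by omega)
    (fun j => C (joinPoints m n a b x j)) fun j =>
    if (j : ℕ) < m then (X : R[X]) else if (j : ℕ) < m + n then 1 else 0
  simp only [Nat.add_sub_cancel] at e₂
  simp only [hj]
  rw [e₂, sum_powersetCard_joinSet]
  · simp only [← map_det_splitVand]
    rw [Polynomial.finsetSum_coeff]
    rw [← Finset.sum_product', eq_comm]
    have w : ∀ u : Finset (Fin m) × Finset (Fin n),
        (∏ j ∈ joinSet u.1 u.2, if (j : ℕ) < m then (X : R[X]) else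
          if (j : ℕ) < m + n then 1 else 0) = X ^ u.1.card := by
      intro u
      rw [prod_joinSet u.1 u.2 fun j => if j < m then (X : R[X]) else if j < m + n then 1 else 0]
      simp
    simp only [w, Polynomial.coeff_mul_C, Polynomial.coeff_X_pow]
    symm
    refine Finset.sum_subset_zero_on_sdiff ?_ ?_ ?_
    · rintro ⟨P, Q⟩ hPQ
      simp only [Finset.mem_product, Finset.mem_powersetCard_univ] at hPQ
      simp only [Finset.mem_filter_univ]
      omega
    · rintro ⟨P, Q⟩ hPQ
      simp only [Finset.mem_sdiff, Finset.mem_product, Finset.mem_powersetCard_univ,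
        Finset.mem_filter_univ] at hPQ
      dsimp only
      rw [if_neg (by omega), zero_mul]
    · rintro ⟨P, Q⟩ hPQ
      simp only [Finset.mem_product, Finset.mem_powersetCard_univ] at hPQ
      dsimp only
      rw [if_pos (by omega), one_mul]
  · intro s hs
    rw [Finset.prod_eq_zero hs, zero_mul]
    simp

end JoinSet

section Sylvester

theorem sresF_eq_fMinor {m n k : ℕ} (hn : k < n) (f g : K[X]) :
    sresF m n k f g = fMinor m n k (f.map C) (g.map C) X := by
  unfold sresF fMinor natDet
  congr 1
  ext1 r c
  have hc := c.2
  simp only [sresMatGen, Matrix.of_apply, Polynomial.coeff_X_pow_mul', Polynomial.coeff_map]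
  split_ifs <;> first | rfl | omega | (congr 2; omega)

theorem sresG_eq_gMinor {m n k : ℕ} (hn : k < n) (f g : K[X]) :
    sresG m n k f g = gMinor m n k (f.map C) (g.map C) X := by
  unfold sresG gMinor natDet
  congr 1
  ext1 r c
  have hc := c.2
  simp only [sresMatGen, Matrix.of_apply, Polynomial.coeff_X_pow_mul', Polynomial.coeff_map]
  split_ifs <;> first | rfl | omega | (congr 2; omega)

theorem sum_powersetCard_compl {M : Type*} [AddCommMonoid M] {N p p' : ℕ} (h : p + p' = N)
    (F : Finset (Fin N) → M) :
    ∑ s ∈ powersetCard p univ, F s = ∑ s ∈ powersetCard p' univ, F sᶜ := by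
  refine Finset.sum_nbij' (fun s => sᶜ) (fun s => sᶜ) ?_ ?_ ?_ ?_ ?_ <;> intro s hs
  · rw [Finset.mem_powersetCard_univ] at hs ⊢
    rw [Finset.card_compl, Fintype.card_fin, hs]
    omega
  · rw [Finset.mem_powersetCard_univ] at hs ⊢
    rw [Finset.card_compl, Fintype.card_fin, hs]
    omega
  · exact compl_compl s
  · exact compl_compl s
  · rw [compl_compl]

theorem vandProd_ne_zero {R : Type*} [CommRing R] [IsDomain R] {N : ℕ} {t : ℕ → R}
    (h : ∀ i < N, ∀ j < N, t i = t j → i = j) : vandProd N t ≠ 0 := by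
  refine Finset.prod_ne_zero_iff.2 fun j hj => Finset.prod_ne_zero_iff.2 fun i hi h0 => ?_
  rw [Finset.mem_range] at hi hj
  have := h i (by omega) j hj (sub_eq_zero.1 h0)
  omega

theorem prod_prod_sub_compl_ne_zero {N : ℕ} {A : Fin N → K} (hA : Function.Injective A)
    (s : Finset (Fin N)) : ∏ i ∈ sᶜ, ∏ j ∈ s, (A i - A j) ≠ 0 := by
  refine Finset.prod_ne_zero_iff.2 fun i hi => Finset.prod_ne_zero_iff.2 fun j hj h0 => ?_
  rw [hA (sub_eq_zero.1 h0)] at hi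
  exact Finset.mem_compl.1 hi hj

/-- The vanishing extension of a finite family of constants to a sequence of polynomials. -/
noncomputable def constSeq {N : ℕ} (A : Fin N → K) (i : ℕ) : K[X] :=
  if h : i < N then C (A ⟨i, h⟩) else 0

theorem constSeq_val {N : ℕ} (A : Fin N → K) (i : Fin N) : constSeq A i = C (A i) := dif_pos i.2

theorem vandProd_constSeq_ne_zero {N : ℕ} {A : Fin N → K} (hA : Function.Injective A) :
    vandProd N (constSeq A) ≠ 0 := by
  refine vandProd_ne_zero fun i hi j hj h => ?_
  rw [constSeq_val A ⟨i, hi⟩, constSeq_val A ⟨j, hj⟩] at h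
  exact congrArg Fin.val (hA (C_injective h))

/-- Sylvester's double sum as a sum of determinants. -/
theorem vandProd_mul_sylvSum {m n p q p' q' d k : ℕ} (hp : p + p' = m) (hq : q + q' = n)
    (hd : d + k + 1 = m + n) (hk : p' + q' = k + 1) {A : Fin m → K} {B : Fin n → K}
    (hA : Function.Injective A) (hB : Function.Injective B) :
    ∑ P ∈ powersetCard p' univ, ∑ Q ∈ powersetCard q' univ, (splitVand (d + 1) (k + 1)
      (fun i : Fin (m + n + 1) => joinPoints m n (constSeq A) (constSeq B) X i)
        (joinSet P Q)).det =
    (-1) ^ (q * p' + m + n) * vandProd m (constSeq A) * vandProd n (constSeq B) *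
      sylvSum A B p q := by
  unfold sylvSum
  rw [sum_powersetCard_compl hp, Finset.mul_sum]
  refine Finset.sum_congr rfl fun P hP => ?_
  rw [sum_powersetCard_compl hq, Finset.mul_sum]
  refine Finset.sum_congr rfl fun Q hQ => ?_
  rw [Finset.mem_powersetCard_univ] at hP hQ
  have hQc : Qᶜ.card = q := by
    rw [Finset.card_compl, Fintype.card_fin, hQ]
    omega
  have e := det_splitVand_joinSet hd (joinPoints m n (constSeq A) (constSeq B) X) P Q (by omega)
  have tA : ∀ i : Fin m, joinPoints m n (constSeq A) (constSeq B) X i = C (A i) := fun i => by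
    rw [joinPoints_left i.2, constSeq_val]
  have tB : ∀ j : Fin n, joinPoints m n (constSeq A) (constSeq B) X (m + j) = C (B j) :=
    fun j => by rw [joinPoints_right j.2, constSeq_val]
  rw [vandProd_congr fun i hi => joinPoints_left hi, vandProd_congr fun j hj => joinPoints_right hj,
    hP, hQc] at e
  simp only [tA, tB, joinPoints_last, ← C_sub, ← map_prod C, ← C_mul] at e
  have hne := mul_ne_zero (prod_prod_sub_compl_ne_zero hA P) (prod_prod_sub_compl_ne_zero hB Q)
  refine mul_right_cancel₀ (C_ne_zero.2 hne) ?_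
  rw [e]
  simp only [compl_compl]
  rw [← mul_assoc _ _ (C (_ / _)), mul_assoc _ (C (_ / _)), ← C_mul, div_mul_cancel₀ _ hne]
  exact (mul_assoc _ _ _).symm

theorem neg_one_pow_sylvester {p q p' q' k : ℕ} (hk : p' + q' = k + 1) (hd : p' ≤ q)
    (hn : 1 ≤ q + q') :
    (-1 : K[X]) ^ (q * p' + (q + q') * (p + q - (p + p')) + (p + q) + (q + q') - q - 1) =
      (-1) ^ (q * p' + (p + p') + (q + q') + q' + (q + q') * k + k) := by
  obtain ⟨u, rfl⟩ := Nat.exists_eq_add_of_le hd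
  refine neg_one_pow_congr (Nat.even_add.1 ?_)
  obtain ⟨l, hl⟩ := Nat.exists_eq_add_of_le hn
  have he : (p' + u + q') * (u + k) = l * (l + 1) := by
    rw [hl, show u + k = l by omega]
    ring
  have e : (p' + u) * p' + (p' + u + q') * (p + (p' + u) - (p + p')) + (p + (p' + u)) +
      (p' + u + q') - (p' + u) - 1 + ((p' + u) * p' + (p + p') + (p' + u + q') + q' +
      (p' + u + q') * k + k) = l * (l + 1) + 2 * ((p' + u) * p' + p + k + l + 1) := by
    rw [← he, show p + (p' + u) - (p + p') = u by omega, mul_add (p' + u + q')]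
    omega
  rw [e]
  exact (Nat.even_mul_succ_self l).add (even_two_mul _)

end Sylvester

/-- **Sylvester (case `n ≤ d ≤ m+n-1`)**: with `k := m+n-d-1` and
`σ := q(m-p)+n(d-m)+d+n-q-1`,
`Sylv^{p,q}(A,B;x) = (-1)^σ·( C(k,m-p)·F_k·f − C(k,n-q)·G_k·g )`. -/
theorem sylvSum_eq_comb {m n : ℕ} (hm : 1 ≤ m) (hn : 1 ≤ n) (hmn : m ≤ n)
    (A : Fin m → K) (B : Fin n → K) (hA : Function.Injective A) (hB : Function.Injective B)
    (f g : Polynomial K) (hf : f = ∏ i, (X - C (A i))) (hg : g = ∏ j, (X - C (B j)))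
    (p q : ℕ) (hp : p ≤ m) (hq : q ≤ n)
    (hd1 : n ≤ p + q) (hd2 : p + q < m + n)
    (k : ℕ) (hk : k = m + n - (p + q) - 1)
    (σ : ℕ) (hσ : σ = q * (m - p) + n * (p + q - m) + (p + q) + n - q - 1) :
    sylvSum A B p q =
      (-1 : Polynomial K) ^ σ *
        ((k.choose (m - p) : Polynomial K) * sresF m n k f g * f -
         (k.choose (n - q) : Polynomial K) * sresG m n k f g * g) := by
  subst hf hg
  obtain ⟨p', rfl⟩ := Nat.exists_eq_add_of_le hp
  obtain ⟨q', rfl⟩ := Nat.exists_eq_add_of_le hq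
  have hk' : p' + q' = k + 1 := by omega
  have hkd : p + q + k + 1 = p + p' + (q + q') := by omega
  have hkm : k < p + p' := by omega
  have hkn : k < q + q' := by omega
  have monic : ∀ {N : ℕ} (A : Fin N → K), ((∏ i, (X - C (A i))).map C : K[X][X]).Monic :=
    fun A => (Polynomial.monic_prod_X_sub_C _ _).map C
  have deg : ∀ {N : ℕ} (A : Fin N → K), ((∏ i, (X - C (A i))).map C : K[X][X]).natDegree = N := by
    intro N A
    rw [Polynomial.natDegree_map_eq_of_injective C_injective,
      Polynomial.natDegree_finsetProd_X_sub_C_eq_card, Finset.card_univ, Fintype.card_fin]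
  have root : ∀ {N : ℕ} (A : Fin N → K), ∀ i < N,
      ((∏ i, (X - C (A i))).map C : K[X][X]).eval (constSeq A i) = 0 := by
    intro N A i hi
    rw [constSeq_val A ⟨i, hi⟩, Polynomial.eval_map_apply, Polynomial.eval_prod,
      Finset.prod_eq_zero (Finset.mem_univ ⟨i, hi⟩) (by simp), C_0]
  have evalX : ∀ h : K[X], (h.map C).eval X = h := fun h => by
    rw [Polynomial.eval_map, Polynomial.eval₂_C_X]
  have e := sum_det_splitVand_joinSet hkd (by omega) hk' (constSeq A) (constSeq B) X
  rw [vandProd_mul_sylvSum rfl rfl hkd hk' hA hB,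
    natDet_left_eq _ _ _ _ hkd hkm hkn _ _ _ _ (monic A) (deg A) (root A) (monic B) (deg B) (root B),
    natDet_right_eq _ _ _ _ hkd hkm hkn _ _ _ _ (monic A) (deg A) (root A) (monic B) (deg B)
      (root B), evalX, evalX, ← sresF_eq_fMinor hkn, ← sresG_eq_gMinor hkn] at e
  have hV := mul_ne_zero (vandProd_constSeq_ne_zero hA) (vandProd_constSeq_ne_zero hB)
  have sq : ((-1 : K[X]) ^ (q * p' + (p + p') + (q + q'))) ^ 2 = 1 := by
    rw [← pow_mul, mul_comm, pow_mul]
    simp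
  rw [hσ, Nat.add_sub_cancel_left, Nat.add_sub_cancel_left,
    neg_one_pow_sylvester hk' (by omega) hn]
  refine mul_left_cancel₀ hV ?_
  rw [pow_add _ _ k, pow_add _ _ ((q + q') * k), pow_add _ _ q']
  rw [pow_succ, pow_add] at e
  linear_combination (-1 : K[X]) ^ (q * p' + (p + p') + (q + q')) * e -
    vandProd (p + p') (constSeq A) * vandProd (q + q') (constSeq B) * sylvSum A B p q * sq
end

section
/- Suppose m = n and let 0 ≤ p ≤ m, 0 ≤ q ≤ m with p + q = m. Then Sylv^{p,q}(A,B;x) = binomial(m−1,q)·f(x) + binomial(m−1,p)·g(x). -/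
open Polynomial Finset

variable {K : Type*} [Field K]

/-- If two polynomials of degree at most `#s` have the same coefficient of `X ^ #s` and agree at
the `#s` points indexed by `s`, then they are equal. -/
theorem eq_of_natDegree_le_of_coeff_eq_of_eval_eq {ι : Type*} {P Q : Polynomial K} {s : Finset ι}
    {v : ι → K} (hv : Set.InjOn v s) (hP : P.natDegree ≤ #s) (hQ : Q.natDegree ≤ #s)
    (hcoeff : P.coeff #s = Q.coeff #s) (heval : ∀ i ∈ s, P.eval (v i) = Q.eval (v i)) :
    P = Q := by
  rw [← sub_eq_zero]
  refine eq_zero_of_degree_lt_of_eval_index_eq_zero s hv ?_ fun i hi => by simp [heval i hi]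
  rw [degree_lt_iff_coeff_zero]
  intro k hk
  rcases hk.eq_or_lt with rfl | hk
  · simp [hcoeff]
  · simp [coeff_eq_zero_of_natDegree_lt (hP.trans_lt hk),
      coeff_eq_zero_of_natDegree_lt (hQ.trans_lt hk)]

theorem coeff_card_prod_X_sub_C {ι : Type*} (s : Finset ι) (v : ι → K) :
    (∏ i ∈ s, (X - C (v i))).coeff #s = 1 := by
  have h := (monic_prod_X_sub_C v s).coeff_natDegree
  rwa [natDegree_finsetProd_X_sub_C_eq_card] at h

section InnerSum

variable {ι κ : Type*} [DecidableEq κ]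

/-- The weight of a subset `B'` of `B` in the double sum, for a fixed pair `(S, T)`. -/
noncomputable def sylvWeight (a : ι → K) (b : κ → K) (S T : Finset ι) (B B' : Finset κ) : K :=
  (∏ i ∈ S, ∏ j ∈ B', (a i - b j)) * (∏ i ∈ T, ∏ j ∈ B \ B', (a i - b j)) /
    ∏ j ∈ B', ∏ j' ∈ B \ B', (b j - b j')

theorem sylvWeight_insert_mul (a : ι → K) {b : κ → K} (hb : Function.Injective b)
    (S T : Finset ι) {B B' : Finset κ} {k : κ} (hk : k ∉ B) (hB' : B' ⊆ B) :
    sylvWeight a b S T (insert k B) (insert k B') * ∏ j ∈ B \ B', (b k - b j) =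
      (∏ i ∈ S, (a i - b k)) * sylvWeight a b S T B B' := by
  have hkB' : k ∉ B' := fun h => hk (hB' h)
  have hsdiff : insert k B \ insert k B' = B \ B' := by
    ext j
    simp only [mem_sdiff, mem_insert]
    grind
  have hne : ∏ j ∈ B \ B', (b k - b j) ≠ 0 :=
    prod_ne_zero_iff.2 fun j hj => sub_ne_zero.2 <| hb.ne <| by
      rintro rfl
      exact hk (mem_sdiff.1 hj).1
  simp only [sylvWeight, hsdiff, prod_insert hkB', prod_mul_distrib]
  field_simp

theorem sum_sylvWeight_mul_prod_eq {a : ι → K} {b : κ → K} (hb : Function.Injective b)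
    {S T : Finset ι} {B : Finset κ} (hcard : #B = #S + #T + 1)
    (ih : ∀ k ∈ B, ∑ B' ∈ powersetCard #T (B.erase k), sylvWeight a b S T (B.erase k) B' =
      ∏ i ∈ S, ∏ k ∈ T, (a i - a k)) :
    ∑ B' ∈ powersetCard (#T + 1) B, C (sylvWeight a b S T B B') * ∏ j ∈ B \ B', (X - C (b j)) =
      C (∏ i ∈ S, ∏ k ∈ T, (a i - a k)) * ∏ i ∈ S, (C (a i) - X) := by
  have hlt : #S < #B := by omega
  refine eq_of_degrees_lt_of_eval_index_eq B hb.injOn ?_ ?_ fun k hk => ?_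
  · refine (degree_le_of_natDegree_le (n := #S) ?_).trans_lt (by exact_mod_cast hlt)
    refine natDegree_sum_le_of_forall_le _ _ fun B' hB' => (natDegree_C_mul_le _ _).trans ?_
    rw [mem_powersetCard] at hB'
    rw [natDegree_finsetProd_X_sub_C_eq_card, card_sdiff_of_subset hB'.1]
    omega
  · refine (degree_le_of_natDegree_le (n := #S) ?_).trans_lt (by exact_mod_cast hlt)
    refine (natDegree_C_mul_le _ _).trans <| (natDegree_prod_le _ _).trans ?_
    refine (sum_le_card_nsmul _ _ 1 fun i _ => ?_).trans (by simp)
    rw [natDegree_sub, natDegree_X_sub_C]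
  · have hkE : k ∉ B.erase k := notMem_erase k B
    have hih := ih k hk
    obtain ⟨E, hE⟩ : ∃ E, E = B.erase k := ⟨_, rfl⟩
    have hB : B = insert k E := by rw [hE, insert_erase hk]
    rw [← hE] at hkE hih
    subst hB
    have hdisj : Disjoint (powersetCard (#T + 1) E) ((powersetCard #T E).image (insert k)) := by
      rw [disjoint_left]
      intro B' h1 h2
      obtain ⟨B'', -, rfl⟩ := mem_image.1 h2
      exact hkE ((mem_powersetCard.1 h1).1 (mem_insert_self _ _))
    have hinj : Set.InjOn (insert k) (powersetCard #T E : Set (Finset κ)) := by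
      intro B₁ h₁ B₂ h₂ h
      have hk₁ : k ∉ B₁ := fun h => hkE ((mem_powersetCard.1 h₁).1 h)
      have hk₂ : k ∉ B₂ := fun h => hkE ((mem_powersetCard.1 h₂).1 h)
      rw [← erase_insert hk₁, h, erase_insert hk₂]
    rw [eval_finsetSum, powersetCard_succ_insert hkE, sum_union hdisj, sum_image hinj,
      sum_eq_zero, zero_add]
    · simp only [eval_mul, eval_C, eval_prod, eval_sub, eval_X]
      rw [← hih, sum_mul]
      refine sum_congr rfl fun B' hB' => ?_
      have hB'E := (mem_powersetCard.1 hB').1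
      rw [insert_sdiff_insert, sdiff_insert_of_notMem hkE,
        sylvWeight_insert_mul a hb S T hkE hB'E, mul_comm]
    · intro B' hB'
      rw [eval_mul, eval_prod, prod_eq_zero (i := k), mul_zero]
      · exact mem_sdiff.2 ⟨mem_insert_self _ _, fun h => hkE ((mem_powersetCard.1 hB').1 h)⟩
      · simp

theorem sum_sylvWeight_eq [DecidableEq ι] (a : ι → K) {b : κ → K} (hb : Function.Injective b)
    (S T : Finset ι) {B : Finset κ} (hcard : #B = #S + #T) :
    ∑ B' ∈ powersetCard #T B, sylvWeight a b S T B B' = ∏ i ∈ S, ∏ k ∈ T, (a i - a k) := by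
  induction T using Finset.induction_on generalizing B with
  | empty => simp [sylvWeight]
  | insert t T ht ih =>
    rw [card_insert_of_notMem ht] at hcard ⊢
    have h := congr_arg (eval (a t)) <| sum_sylvWeight_mul_prod_eq (a := a) hb
      (hcard.trans (add_assoc _ _ _).symm) fun k hk => ih (by rw [card_erase_of_mem hk]; omega)
    simp only [eval_finsetSum, eval_mul, eval_C, eval_prod, eval_sub, eval_X] at h
    simp only [prod_insert ht, prod_mul_distrib]
    rw [mul_comm, ← h]
    refine sum_congr rfl fun B' _ => ?_
    simp only [sylvWeight, prod_insert ht]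
    ring

theorem sum_sylvWeight_eq_neg_one_pow_mul [DecidableEq ι] (a : ι → K) {b : κ → K}
    (hb : Function.Injective b) (S T : Finset ι) {B : Finset κ} (hcard : #B = #S + #T + 1) :
    ∑ B' ∈ powersetCard (#T + 1) B, sylvWeight a b S T B B' =
      (-1) ^ #S * ∏ i ∈ S, ∏ k ∈ T, (a i - a k) := by
  have h := congr_arg (coeff · #S) <| sum_sylvWeight_mul_prod_eq (a := a) hb hcard
    fun k hk => sum_sylvWeight_eq a hb S T (by rw [card_erase_of_mem hk]; omega)
  have hneg : ∏ i ∈ S, (C (a i) - X) = C ((-1) ^ #S) * ∏ i ∈ S, (X - C (a i)) := by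
    rw [C_pow, ← prod_const, ← prod_mul_distrib]
    exact prod_congr rfl fun i _ => by simp
  simp only [hneg, finsetSum_coeff, coeff_C_mul, coeff_card_prod_X_sub_C, mul_one] at h
  rw [mul_comm, ← h]
  refine sum_congr rfl fun B' hB' => ?_
  rw [mem_powersetCard] at hB'
  have : #S = #(B \ B') := by rw [card_sdiff_of_subset hB'.1]; omega
  rw [this, coeff_card_prod_X_sub_C, mul_one]

end InnerSum

theorem sylvSum_eq_sum_sylvWeight {m n : ℕ} (A : Fin m → K) (B : Fin n → K) (p q : ℕ) :
    sylvSum A B p q = ∑ S ∈ powersetCard p univ, ∑ S' ∈ powersetCard q univ,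
      (∏ i ∈ S, (X - C (A i))) * (∏ j ∈ S', (X - C (B j))) *
        C (sylvWeight A B S Sᶜ univ S' / ∏ i ∈ S, ∏ i' ∈ Sᶜ, (A i - A i')) := by
  refine sum_congr rfl fun S _ => sum_congr rfl fun S' _ => ?_
  rw [sylvWeight, ← compl_eq_univ_sdiff, div_div, mul_comm (∏ j ∈ S', _) (∏ i ∈ S, _)]

theorem prod_prod_compl_sub_ne_zero {ι : Type*} [Fintype ι] [DecidableEq ι] {a : ι → K}
    (ha : Function.Injective a) {S T : Finset ι} (hT : T ⊆ Sᶜ) :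
    ∏ i ∈ S, ∏ k ∈ T, (a i - a k) ≠ 0 :=
  prod_ne_zero_iff.2 fun i hi => prod_ne_zero_iff.2 fun k hk => sub_ne_zero.2 <| ha.ne <| by
    rintro rfl
    exact mem_compl.1 (hT hk) hi

theorem natDegree_prod_X_sub_C_mul_prod_X_sub_C {ι κ : Type*} (a : ι → K) (b : κ → K)
    (S : Finset ι) (S' : Finset κ) :
    ((∏ i ∈ S, (X - C (a i))) * ∏ j ∈ S', (X - C (b j))).natDegree = #S + #S' := by
  rw [(monic_prod_X_sub_C a S).natDegree_mul (monic_prod_X_sub_C b S')]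
  simp

theorem natDegree_sylvSum_le {m n : ℕ} (A : Fin m → K) (B : Fin n → K) (p q : ℕ) :
    (sylvSum A B p q).natDegree ≤ p + q := by
  rw [sylvSum]
  refine natDegree_sum_le_of_forall_le _ _ fun S hS =>
    natDegree_sum_le_of_forall_le _ _ fun S' hS' => ?_
  refine (natDegree_mul_C_le _ _).trans ?_
  rw [natDegree_prod_X_sub_C_mul_prod_X_sub_C, (mem_powersetCard.1 hS).2,
    (mem_powersetCard.1 hS').2]

theorem coeff_sylvSum {m : ℕ} {A B : Fin m → K} (hA : Function.Injective A)
    (hB : Function.Injective B) {p q : ℕ} (hpq : p + q = m) :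
    (sylvSum A B p q).coeff m = m.choose p := by
  have key : ∀ S ∈ powersetCard p (univ : Finset (Fin m)),
      (∑ S' ∈ powersetCard q univ, (∏ i ∈ S, (X - C (A i))) * (∏ j ∈ S', (X - C (B j))) *
        C (sylvWeight A B S Sᶜ univ S' / ∏ i ∈ S, ∏ i' ∈ Sᶜ, (A i - A i'))).coeff m = 1 := by
    intro S hS
    have hSp := (mem_powersetCard.1 hS).2
    have hSc : #Sᶜ = q := by rw [card_compl, Fintype.card_fin]; omega
    have hsum := sum_sylvWeight_eq A hB S Sᶜ (B := univ) (by rw [card_fin]; omega)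
    rw [finsetSum_coeff, ← div_self (prod_prod_compl_sub_ne_zero hA (Subset.refl Sᶜ))]
    conv_rhs => lhs; rw [← hsum, hSc]
    rw [sum_div]
    refine sum_congr rfl fun S' hS' => ?_
    have hd := natDegree_prod_X_sub_C_mul_prod_X_sub_C A B S S'
    rw [hSp, (mem_powersetCard.1 hS').2, hpq] at hd
    have hm := ((monic_prod_X_sub_C A S).mul (monic_prod_X_sub_C B S')).coeff_natDegree
    rw [hd] at hm
    rw [coeff_mul_C, hm, one_mul]
  rw [sylvSum_eq_sum_sylvWeight, finsetSum_coeff, sum_congr rfl key]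
  simp

theorem eval_sylvSum {m : ℕ} {A B : Fin m → K} (hA : Function.Injective A)
    (hB : Function.Injective B) {p q : ℕ} (hpq : p + q = m) (k : Fin m) :
    (sylvSum A B p q).eval (A k) = (m - 1).choose p * ∏ j, (A k - B j) := by
  have key : ∀ S ∈ powersetCard p (univ.erase k),
      eval (A k) (∑ S' ∈ powersetCard q univ,
        (∏ i ∈ S, (X - C (A i))) * (∏ j ∈ S', (X - C (B j))) *
        C (sylvWeight A B S Sᶜ univ S' / ∏ i ∈ S, ∏ i' ∈ Sᶜ, (A i - A i'))) =
      ∏ j, (A k - B j) := by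
    intro S hS
    obtain ⟨hSk, hSp⟩ := mem_powersetCard.1 hS
    have hkS : k ∉ S := fun h => notMem_erase k _ (hSk h)
    obtain ⟨T, hT⟩ : ∃ T, T = Sᶜ.erase k := ⟨_, rfl⟩
    have hkT : k ∉ T := hT ▸ notMem_erase k _
    have hSc : Sᶜ = insert k T := by rw [hT, insert_erase (mem_compl.2 hkS)]
    have hTq : #T + 1 = q := by
      rw [← card_insert_of_notMem hkT, ← hSc, card_compl, Fintype.card_fin]; omega
    have hne := prod_prod_compl_sub_ne_zero hA (S := S) (T := T) (hSc ▸ subset_insert k T)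
    have hne' : ∏ i ∈ S, (A k - A i) ≠ 0 :=
      prod_ne_zero_iff.2 fun i hi => sub_ne_zero.2 <| hA.ne <| by
        rintro rfl
        exact hkS hi
    have hneg : ∏ i ∈ S, (A i - A k) = (-1) ^ #S * ∏ i ∈ S, (A k - A i) := by
      rw [← prod_const, ← prod_mul_distrib]
      exact prod_congr rfl fun i _ => by ring
    have hsum := sum_sylvWeight_eq_neg_one_pow_mul A hB S T (B := univ) (by rw [card_fin]; omega)
    rw [hTq] at hsum
    calc _ = ∑ S' ∈ powersetCard q univ, (∏ j, (A k - B j)) *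
          (sylvWeight A B S T univ S' / ((-1) ^ #S * ∏ i ∈ S, ∏ k ∈ T, (A i - A k))) := by
          rw [eval_finsetSum]
          refine sum_congr rfl fun S' _ => ?_
          rw [← prod_mul_prod_compl S' fun j => A k - B j]
          simp only [hSc, eval_mul, eval_C, eval_prod, eval_sub, eval_X, sylvWeight,
            prod_insert hkT, prod_mul_distrib, hneg, ← compl_eq_univ_sdiff]
          have : (-1 : K) ^ #S ≠ 0 := by simp
          field_simp
      _ = _ := by
          rw [← mul_sum, ← sum_div, hsum, div_self (mul_ne_zero (by simp) hne), mul_one]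
  have hsub : powersetCard p (univ.erase k) ⊆ powersetCard p univ :=
    powersetCard_mono (erase_subset _ _)
  rw [sylvSum_eq_sum_sylvWeight, eval_finsetSum, ← sum_subset hsub, sum_congr rfl key]
  · simp
  · intro S hS hS'
    have hkS : k ∈ S := by
      by_contra h
      exact hS' (mem_powersetCard.2 ⟨subset_erase.2 ⟨subset_univ _, h⟩, (mem_powersetCard.1 hS).2⟩)
    have hzero : eval (A k) (∏ i ∈ S, (X - C (A i))) = 0 := by
      rw [eval_prod]
      exact prod_eq_zero hkS (by simp)
    simp only [eval_finsetSum, eval_mul, hzero, zero_mul, sum_const_zero]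

/-- **Sylvester (case `m = d = n`)**: for `p + q = m = n`,
`Sylv^{p,q}(A,B;x) = C(m-1,q)·f(x) + C(m-1,p)·g(x)`. -/
theorem sylvSum_eq_f_add_g {m : ℕ} (hm : 1 ≤ m)
    (A : Fin m → K) (B : Fin m → K) (hA : Function.Injective A) (hB : Function.Injective B)
    (f g : Polynomial K) (hf : f = ∏ i, (X - C (A i))) (hg : g = ∏ j, (X - C (B j)))
    (p q : ℕ) (hp : p ≤ m) (hq : q ≤ m) (hpq : p + q = m) :
    sylvSum A B p q =
      ((m - 1).choose q : Polynomial K) * f + ((m - 1).choose p : Polynomial K) * g := by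
  have hdeg (v : Fin m → K) : (∏ i, (X - C (v i))).natDegree = m := by simp
  have hcoeff (v : Fin m → K) : (∏ i, (X - C (v i))).coeff m = 1 := by
    simpa using coeff_card_prod_X_sub_C univ v
  have hchoose : m.choose p = (m - 1).choose q + (m - 1).choose p := by
    obtain ⟨m, rfl⟩ := Nat.exists_eq_add_of_le' hm
    rcases p with _ | p
    · obtain rfl : q = m + 1 := by omega
      simp
    · rw [Nat.choose_succ_succ, Nat.add_sub_cancel,
        Nat.choose_symm_of_eq_add (by omega : m = p + q)]
  subst hf hg
  simp only [← C_eq_natCast]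
  refine eq_of_natDegree_le_of_coeff_eq_of_eval_eq (s := univ) hA.injOn ?_ ?_ ?_ fun k _ => ?_
  · rw [card_fin]
    exact (natDegree_sylvSum_le A B p q).trans hpq.le
  · rw [card_fin]
    exact natDegree_add_le_of_degree_le ((natDegree_C_mul_le _ _).trans (hdeg A).le)
      ((natDegree_C_mul_le _ _).trans (hdeg B).le)
  · rw [card_fin, coeff_sylvSum hA hB hpq, coeff_add, coeff_C_mul, coeff_C_mul, hcoeff, hcoeff,
      hchoose]
    push_cast
    ring
  · have hzero : ∏ i, (A k - A i) = 0 := prod_eq_zero (mem_univ k) (sub_self _)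
    simp [eval_sylvSum hA hB hpq, eval_prod, hzero]
end
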